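/- arXiv:1604.08029 — 2 statements merged into one kernel-verified Lean document; each statement's English description precedes it below -/
import Mathlib

section
/- Let {u_β}_{β ∈ I} be a nonempty family of ω-subharmonic functions on Ω that is locally uniformly bounded above. Put u(z) := sup_{β ∈ I} u_β(z) and let u* denote the upper semicontinuous regularization of u, i.e., u*(z) = limsup_{w → z} u(w). Then u* is ω-subharmonic on Ω. -/
open scoped BigOperators ComplexOrder
open MeasureTheory Filter Topology

noncomputable section

/-- `ℂ^n`. -/
abbrev Cz (n : ℕ) := Fin n → ℂ

/-- Wirtinger derivative `∂f/∂z_i`. -/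
def wder {n : ℕ} (i : Fin n) (f : Cz n → ℂ) (z : Cz n) : ℂ :=
  (fderiv ℝ f z (Pi.single i 1) - Complex.I * fderiv ℝ f z (Pi.single i Complex.I)) / 2

/-- Conjugate Wirtinger derivative `∂f/∂z̄_i`. -/
def wderBar {n : ℕ} (i : Fin n) (f : Cz n → ℂ) (z : Cz n) : ℂ :=
  (fderiv ℝ f z (Pi.single i 1) + Complex.I * fderiv ℝ f z (Pi.single i Complex.I)) / 2

/-- `∂²f/∂z_i ∂z̄_j` of a complex-valued function. -/
def cHessC {n : ℕ} (f : Cz n → ℂ) (i j : Fin n) (z : Cz n) : ℂ :=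
  wder i (wderBar j f) z

/-- `∂²u/∂z_i ∂z̄_j` of a real-valued function. -/
def cHess {n : ℕ} (u : Cz n → ℝ) (i j : Fin n) (z : Cz n) : ℂ :=
  cHessC (fun w => (u w : ℂ)) i j z

/-- `Δ_ω h = Σ_{i,j} ω^{j̄ i} ∂²h/∂z_i ∂z̄_j`. -/
def wLap {n : ℕ} (ω : Cz n → Matrix (Fin n) (Fin n) ℂ) (h : Cz n → ℝ) (z : Cz n) : ℂ :=
  ∑ i, ∑ j, (ω z)⁻¹ i j * cHess h i j z

/-- `ω` is a smooth Hermitian metric on `S`. -/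
def IsHermitianMetricOn {n : ℕ} (ω : Cz n → Matrix (Fin n) (Fin n) ℂ) (S : Set (Cz n)) : Prop :=
  (∀ i j, ContDiffOn ℝ ((⊤ : ℕ∞) : WithTop ℕ∞) (fun z => ω z i j) S) ∧ ∀ z ∈ S, (ω z).PosDef

/-- `u : W → [-∞, +∞)` is `ω`-subharmonic on `W`: it is upper semicontinuous and
locally integrable on `W`, and it satisfies the comparison principle against continuous
`Δ_ω`-harmonic functions on relatively compact open subsets of `W`. -/
structure OmegaSH {n : ℕ} (ω : Cz n → Matrix (Fin n) (Fin n) ℂ) (W : Set (Cz n))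
    (u : Cz n → EReal) : Prop where
  ne_top : ∀ z ∈ W, u z ≠ ⊤
  usc : UpperSemicontinuousOn u W
  locInt : LocallyIntegrableOn (fun z => (u z).toReal) W volume
  ae_ne_bot : ∀ᵐ z ∂(volume.restrict W), u z ≠ ⊥
  maxPrinciple : ∀ D : Set (Cz n), IsOpen D → IsCompact (closure D) → closure D ⊆ W →
    ∀ h : Cz n → ℝ, ContinuousOn h (closure D) → ContDiffOn ℝ 2 h D →
      (∀ z ∈ D, wLap ω h z = 0) →
      (∀ z ∈ frontier D, u z ≤ (h z : EReal)) →
      ∀ z ∈ closure D, u z ≤ (h z : EReal)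

/-- The function `z ↦ limsup_{w → z} f w` is upper semicontinuous. -/
theorem upperSemicontinuous_limsup_nhds {X : Type*} [TopologicalSpace X] (f : X → EReal) :
    UpperSemicontinuous fun z => limsup f (𝓝 z) := by
  intro x y hxy
  obtain ⟨c, hxc, hcy⟩ := exists_between hxy
  filter_upwards [(eventually_lt_of_limsup_lt hxc).eventually_nhds] with w hw
  exact (limsup_le_of_le (h := hw.mono fun _ h => h.le)).trans_lt hcy

theorem le_limsup_nhds {X : Type*} [TopologicalSpace X] (f : X → EReal) (z : X) :
    f z ≤ limsup f (𝓝 z) :=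
  le_limsup_of_frequently_le (frequently_iff.2 fun hU => ⟨z, mem_of_mem_nhds hU, le_rfl⟩)

theorem limsup_nhds_le_of_isOpen {X : Type*} [TopologicalSpace X] {f : X → EReal} {s : Set X}
    (hs : IsOpen s) {c : EReal} (hf : ∀ w ∈ s, f w ≤ c) {z : X} (hz : z ∈ s) :
    limsup f (𝓝 z) ≤ c :=
  limsup_le_of_le (h := mem_of_superset (hs.mem_nhds hz) hf)

theorem EReal.abs_toReal_le_of_le_of_le {a b : EReal} {M : ℝ} (ha : a ≠ ⊥) (hab : a ≤ b)
    (hb : b ≤ M) : |b.toReal| ≤ |a.toReal| + |M| := by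
  have hbt : b ≠ ⊤ := ne_top_of_le_ne_top (EReal.coe_ne_top M) hb
  have h₁ : a.toReal ≤ b.toReal := EReal.toReal_le_toReal hab ha hbt
  have h₂ : b.toReal ≤ M := by
    simpa using EReal.toReal_le_toReal hb (ne_bot_of_le_ne_bot ha hab) (EReal.coe_ne_top M)
  rw [abs_le]
  constructor
  · linarith [neg_abs_le a.toReal, abs_nonneg M]
  · linarith [le_abs_self M, abs_nonneg a.toReal]

/-- The upper semicontinuous regularisation of the supremum of a
locally uniformly bounded above family of `ω`-subharmonic functions is `ω`-subharmonic. -/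
theorem stmt14 (n : ℕ) (Ω : Set (Cz n)) (hΩo : IsOpen Ω) (hΩb : Bornology.IsBounded Ω)
    (ω : Cz n → Matrix (Fin n) (Fin n) ℂ) (hω : IsHermitianMetricOn ω Ω)
    (I : Type) (hI : Nonempty I)
    (u : I → Cz n → EReal) (hu : ∀ β, OmegaSH ω Ω (u β))
    (hbd : ∀ K : Set (Cz n), IsCompact K → K ⊆ Ω →
      ∃ M : ℝ, ∀ β, ∀ z ∈ K, u β z ≤ (M : EReal))
    (U Ustar : Cz n → EReal)
    (hU : ∀ z, U z = ⨆ β, u β z)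
    (hUs : ∀ z, Ustar z = limsup U (𝓝 z)) :
    OmegaSH ω Ω Ustar := by
  obtain rfl : Ustar = fun z => limsup U (𝓝 z) := funext hUs
  have hleU : ∀ β z, u β z ≤ U z := fun β z => (hU z).symm ▸ le_iSup (fun β => u β z) β
  have hle : ∀ β z, u β z ≤ limsup U (𝓝 z) := fun β z => (hleU β z).trans (le_limsup_nhds U z)
  have husc := upperSemicontinuous_limsup_nhds U
  have hbound : ∀ z ∈ Ω, ∃ V : Set (Cz n), IsOpen V ∧ z ∈ V ∧
      ∃ M : ℝ, ∀ w ∈ V, limsup U (𝓝 w) ≤ (M : EReal) := by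
    intro z hz
    obtain ⟨K, hK, hzK, hKΩ⟩ := exists_compact_subset hΩo hz
    obtain ⟨M, hM⟩ := hbd K hK hKΩ
    refine ⟨interior K, isOpen_interior, hzK, M, fun w hw => ?_⟩
    refine limsup_nhds_le_of_isOpen isOpen_interior (fun v hv => ?_) hw
    exact (hU v).symm ▸ iSup_le fun β => hM β v (interior_subset hv)
  obtain ⟨β₀⟩ := hI
  refine ⟨fun z hz => ?_, husc.upperSemicontinuousOn Ω, fun z hz => ?_, ?_, ?_⟩
  · obtain ⟨V, -, hzV, M, hM⟩ := hbound z hz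
    exact ne_top_of_le_ne_top (EReal.coe_ne_top M) (hM z hzV)
  · obtain ⟨V, hVo, hzV, M, hM⟩ := hbound z hz
    obtain ⟨s, hs, hs_int⟩ := (hu β₀).locInt z hz
    refine ⟨s ∩ (V ∩ Ω), inter_mem hs (inter_mem (mem_nhdsWithin_of_mem_nhds (hVo.mem_nhds hzV))
      self_mem_nhdsWithin), ?_⟩
    have hfin : volume (s ∩ (V ∩ Ω)) < ⊤ :=
      (measure_mono fun w hw => hw.2.2).trans_lt hΩb.measure_lt_top
    have hdom : IntegrableOn (fun w => |(u β₀ w).toReal| + |M|) (s ∩ (V ∩ Ω)) volume :=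
      (hs_int.mono_set Set.inter_subset_left).abs.add (integrableOn_const hfin.ne)
    refine hdom.mono' husc.measurable.ereal_toReal.aestronglyMeasurable ?_
    have hV : ∀ᵐ w ∂volume.restrict (s ∩ (V ∩ Ω)), w ∈ V :=
      ae_restrict_of_ae_restrict_of_subset (fun w hw => hw.2.1)
        (ae_restrict_mem hVo.measurableSet)
    have hbot : ∀ᵐ w ∂volume.restrict (s ∩ (V ∩ Ω)), u β₀ w ≠ ⊥ :=
      ae_restrict_of_ae_restrict_of_subset (fun w hw => hw.2.2) (hu β₀).ae_ne_bot
    filter_upwards [hV, hbot] with w hwV hw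
    exact EReal.abs_toReal_le_of_le_of_le hw (hle β₀ w) (hM w hwV)
  · filter_upwards [(hu β₀).ae_ne_bot] with z hz
    exact ne_bot_of_le_ne_bot hz (hle β₀ z)
  · intro D hD hDc hDΩ h hcont hsmooth hharm hfr z hz
    by_cases hzD : z ∈ D
    · have hUh : ∀ w ∈ closure D, U w ≤ (h w : EReal) := fun w hw =>
        (hU w).symm ▸ iSup_le fun β => (hu β).maxPrinciple D hD hDc hDΩ h hcont hsmooth hharm
          (fun v hv => (hle β v).trans (hfr v hv)) w hw
      have hlim : Tendsto (fun w => (h w : EReal)) (𝓝 z) (𝓝 (h z : EReal)) :=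
        (continuous_coe_real_ereal.tendsto (h z)).comp
          (hcont.continuousAt (mem_of_superset (hD.mem_nhds hzD) subset_closure))
      rw [← hlim.limsup_eq]
      exact limsup_le_limsup (mem_of_superset (hD.mem_nhds hzD) fun w hw =>
        hUh w (subset_closure hw))
    · exact hfr z (by rw [hD.frontier_eq]; exact ⟨hz, hzD⟩)
end
end

section
/- If u and v are ω-subharmonic functions on Ω and u = v Lebesgue-almost everywhere on Ω, then u = v everywhere on Ω. -/
open scoped BigOperators ComplexOrder
open MeasureTheory Filter Topology

noncomputable section

section Contact

variable {E : Type*} [NormedAddCommGroup E] [InnerProductSpace ℝ E]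

open scoped RealInnerProductSpace

/-- A map from a set of positive measure that expands distances cannot have a null image. -/
theorem measure_eq_zero_of_antilipschitz [FiniteDimensional ℝ E] [MeasurableSpace E] [BorelSpace E]
    (μ : Measure E) [μ.IsAddHaarMeasure] {P : Set E} {f : E → E} {K : ℝ} (hK : 0 ≤ K)
    (hf : ∀ p ∈ P, ∀ q ∈ P, ‖p - q‖ ≤ K * ‖f p - f q‖) (h0 : μ (f '' P) = 0) : μ P = 0 := by
  set d : ℝ := (Module.finrank ℝ E : ℝ)
  have hac : μ ≪ (μH[d] : Measure E) := Measure.absolutelyContinuous_isAddHaarMeasure _ _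
  have hac' : (μH[d] : Measure E) ≪ μ := Measure.absolutelyContinuous_isAddHaarMeasure _ _
  apply hac
  have hanti : AntilipschitzWith K.toNNReal (fun p : P => f p) := by
    apply AntilipschitzWith.of_le_mul_dist
    intro p q
    simpa [dist_eq_norm, Subtype.dist_eq, hK] using hf p p.2 q q.2
  have h1 := hanti.le_hausdorffMeasure_image (d := d) (by positivity) Set.univ
  have h2 : (fun p : P => f p) '' Set.univ = f '' P := by
    ext; simp
  rw [h2, hac' h0, mul_zero] at h1
  have h3 := (isometry_subtype_coe (s := P)).hausdorffMeasure_image (d := d)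
    (Or.inl (by positivity)) Set.univ
  rw [Set.image_univ, Subtype.range_coe] at h3
  rw [h3]
  exact le_antisymm h1 zero_le

set_option maxHeartbeats 800000 in
/-- The slopes of two supporting affine functions of `U - C‖· - z₀‖²` are controlled by the distance
of the contact points, provided that no quadratic function that is strongly concave
in one direction touches `U` from above. -/
theorem slope_le_of_contact [FiniteDimensional ℝ E] {U : E → ℝ} {z₀ x y p q : E} {r C A τ : ℝ}
    (hC : 0 < C) (hA : 1 ≤ A) (hτ : 0 < τ)
    (husc : UpperSemicontinuousOn U (Metric.closedBall z₀ r))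
    (hU : ∀ x ∈ Metric.ball z₀ r, ∀ e : E, ‖e‖ = 1 → ∀ a > 0, ∀ p : E,
      ¬ ∀ᶠ y in 𝓝 x, U y ≤ U x + ⟪p, y - x⟫ + a * ‖y - x‖ ^ 2 - A * a * ⟪e, y - x⟫ ^ 2)
    (hxr : ∀ z, ‖z - x‖ ≤ (20 * A + 2) * τ → z ∈ Metric.ball z₀ r)
    (hy : y ∈ Metric.closedBall z₀ r)
    (hp : ∀ z ∈ Metric.closedBall z₀ r,
      U z ≤ U x + C * (‖z - z₀‖ ^ 2 - ‖x - z₀‖ ^ 2) + ⟪p, z - x⟫)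
    (hq : ∀ z ∈ Metric.closedBall z₀ r,
      U z ≤ U y + C * (‖z - z₀‖ ^ 2 - ‖y - z₀‖ ^ 2) + ⟪q, z - y⟫)
    (hxy : ‖x - y‖ ≤ τ) : ‖p - q‖ ≤ 20 * A * C * τ := by
  by_contra! hlt
  have hpos : 0 < ‖q - p‖ := by rw [norm_sub_rev]; exact lt_of_le_of_lt (by positivity) hlt
  set s : ℝ := ‖q - p‖ with hs
  set e : E := s⁻¹ • (q - p) with he
  have hen : ‖e‖ = 1 := by rw [he, norm_smul, norm_inv, norm_norm, inv_mul_cancel₀ hpos.ne']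
  have hse : s • e = q - p := by rw [he, smul_smul, mul_inv_cancel₀ hpos.ne', one_smul]
  set β : ℝ := (2 * A - 1) * C with hβ
  have hβ0 : 0 < β := by rw [hβ]; apply mul_pos <;> linarith
  -- the test function, up to affine terms
  set Q : E → ℝ := fun z => 3 * β * τ * ⟪e, z - x⟫ - β * ⟪e, z - x⟫ ^ 2 +
    C * (‖z - x‖ ^ 2 - ⟪e, z - x⟫ ^ 2) with hQ
  set F : E → ℝ := fun z => U z + -(U x + C * (‖z - z₀‖ ^ 2 - ‖x - z₀‖ ^ 2) + ⟪p, z - x⟫ + Q z) with hF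
  set N : Set E := {z | |⟪e, z - x⟫| ≤ 2 * τ ∧ ‖z - x‖ ^ 2 ≤ ⟪e, z - x⟫ ^ 2 + (20 * A * τ) ^ 2}
    with hN
  have hNball : ∀ z ∈ N, z ∈ Metric.ball z₀ r := by
    rintro z ⟨h1, h2⟩
    apply hxr
    have h3 : ⟪e, z - x⟫ ^ 2 ≤ (2 * τ) ^ 2 := sq_le_sq' (by linarith [abs_le.1 h1]) (abs_le.1 h1).2
    apply abs_le_of_sq_le_sq' _ (by positivity) |>.2
    nlinarith [mul_pos (show 0 < A by linarith) (mul_pos hτ hτ)]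
  have hNcl : IsClosed N := by
    apply IsClosed.inter
    · exact isClosed_le (f := fun z => |⟪e, z - x⟫|) (by fun_prop) continuous_const
    · exact isClosed_le (f := fun z => ‖z - x‖ ^ 2)
        (g := fun z => ⟪e, z - x⟫ ^ 2 + (20 * A * τ) ^ 2) (by fun_prop) (by fun_prop)
  have hNcpt : IsCompact N :=
    (isCompact_closedBall z₀ r).of_isClosed_subset hNcl
      fun z hz => Metric.ball_subset_closedBall (hNball z hz)
  have hxN : x ∈ N := by simp [hN]; constructor <;> positivity
  have hFusc : UpperSemicontinuousOn F N := by
    apply UpperSemicontinuousOn.add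
    · exact husc.mono fun z hz => Metric.ball_subset_closedBall (hNball z hz)
    · apply ContinuousOn.upperSemicontinuousOn
      fun_prop
  obtain ⟨z, hz, hmax⟩ := hFusc.exists_isMaxOn ⟨x, hxN⟩ hNcpt
  have hFx : F x = 0 := by simp [hF, hQ]
  have hFz : 0 ≤ F z := hFx ▸ hmax hxN
  have hzb := Metric.ball_subset_closedBall (hNball z hz)
  set t : ℝ := ⟪e, z - x⟫ with ht
  have hb1 : F z ≤ - Q z := by
    have := hp z hzb
    simp only [hF]; linarith
  have hb2 : F z ≤ s * (t + τ) - Q z := by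
    have h1 := hq z hzb
    have h2 := hp y hy
    have h3 : s * t = ⟪q, z - x⟫ - ⟪p, z - x⟫ := by
      rw [ht, ← real_inner_smul_left, hse, inner_sub_left]
    have h4 : ⟪q - p, x - y⟫ ≤ s * τ :=
      (real_inner_le_norm _ _).trans (by gcongr)
    have h5 : ⟪q, z - y⟫ = ⟪q, z - x⟫ + ⟪q, x - y⟫ := by rw [← inner_add_right]; congr 1; abel
    have h6 : ⟪p, y - x⟫ = - ⟪p, x - y⟫ := by rw [← inner_neg_right]; congr 1; abel
    rw [inner_sub_left] at h4
    simp only [hF]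
    nlinarith
  have hQz : Q z = 3 * β * τ * t - β * t ^ 2 + C * (‖z - x‖ ^ 2 - t ^ 2) := rfl
  have hts : t ^ 2 ≤ ‖z - x‖ ^ 2 := by
    have := abs_real_inner_le_norm e (z - x)
    rw [hen, one_mul] at this
    exact sq_le_sq' (by linarith [(abs_le.1 this).1]) (abs_le.1 this).2
  have hC1 : 0 ≤ C * (‖z - x‖ ^ 2 - t ^ 2) := mul_nonneg hC.le (by linarith)
  have hβτ : 0 < β * τ ^ 2 := by positivity
  have hsβ : 10 * β * τ < s := by
    rw [norm_sub_rev, ← hs] at hlt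
    refine lt_of_le_of_lt ?_ hlt
    rw [hβ]; nlinarith [mul_pos hC hτ]
  obtain ⟨hz1, hz2⟩ := hz
  rw [← ht] at hz1 hz2
  obtain ⟨hz1l, hz1r⟩ := abs_le.1 hz1
  have hr : t < 2 * τ := by
    refine lt_of_le_of_ne hz1r fun h => ?_
    rw [h] at hQz hC1
    nlinarith
  have hl : -(2 * τ) < t := by
    refine lt_of_le_of_ne hz1l fun h => ?_
    rw [← h] at hQz hC1 hb2
    nlinarith
  have hlat : ‖z - x‖ ^ 2 < t ^ 2 + (20 * A * τ) ^ 2 := by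
    refine lt_of_le_of_ne hz2 fun h => ?_
    rw [h] at hQz
    have h1 : 10 * (2 * A - 1) < 400 * A ^ 2 := by nlinarith
    have h2 : 10 * (2 * A - 1) * (C * τ ^ 2) < 400 * A ^ 2 * (C * τ ^ 2) :=
      mul_lt_mul_of_pos_right h1 (by positivity)
    have h3 : t ^ 2 ≤ (2 * τ) ^ 2 := sq_le_sq' hl.le hr.le
    have h4 : 0 ≤ τ * (t + 2 * τ) := mul_nonneg hτ.le (by linarith)
    have h5 : 0 ≤ β * (3 * τ * t - t ^ 2 + 10 * τ ^ 2) := mul_nonneg hβ0.le (by linarith)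
    have h6 : 10 * β * τ ^ 2 = 10 * (2 * A - 1) * (C * τ ^ 2) := by rw [hβ]; ring
    linarith
  have hnhds : N ∈ 𝓝 z := by
    have h1 : ∀ᶠ w in 𝓝 z, |⟪e, w - x⟫| < 2 * τ :=
      (by fun_prop : Continuous fun w => |⟪e, w - x⟫|).continuousAt.eventually_lt
        continuousAt_const (by rw [← ht]; exact abs_lt.2 ⟨hl, hr⟩)
    have h2 : ∀ᶠ w in 𝓝 z, ‖w - x‖ ^ 2 < ⟪e, w - x⟫ ^ 2 + (20 * A * τ) ^ 2 :=
      (by fun_prop : Continuous fun w => ‖w - x‖ ^ 2).continuousAt.eventually_lt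
        (by fun_prop : Continuous fun w => ⟪e, w - x⟫ ^ 2 + (20 * A * τ) ^ 2).continuousAt hlat
    filter_upwards [h1, h2] with w hw1 hw2 using ⟨hw1.le, hw2.le⟩
  refine hU z (hNball z ⟨hz1, hz2⟩) e hen (2 * C) (by positivity)
    ((2 * C) • (z - z₀) + p + (3 * β * τ - 2 * β * t - 2 * C * t) • e + (2 * C) • (z - x)) ?_
  filter_upwards [hnhds] with w hw
  have hw' : F w ≤ F z := hmax hw
  have e1 : ‖w - z₀‖ ^ 2 = ‖w - z‖ ^ 2 + 2 * ⟪z - z₀, w - z⟫ + ‖z - z₀‖ ^ 2 := by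
    rw [show w - z₀ = (w - z) + (z - z₀) by abel, norm_add_sq_real, real_inner_comm]
  have e2 : ‖w - x‖ ^ 2 = ‖w - z‖ ^ 2 + 2 * ⟪z - x, w - z⟫ + ‖z - x‖ ^ 2 := by
    rw [show w - x = (w - z) + (z - x) by abel, norm_add_sq_real, real_inner_comm]
  have e3 : ⟪e, w - x⟫ = ⟪e, w - z⟫ + t := by
    rw [ht, ← inner_add_right]; congr 1; abel
  have e4 : ⟪p, w - x⟫ = ⟪p, w - z⟫ + ⟪p, z - x⟫ := by
    rw [← inner_add_right]; congr 1; abel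
  simp only [hF, hQ, e1, e2, e3, e4] at hw'
  simp only [inner_add_left, real_inner_smul_left]
  rw [← ht] at hw'
  rw [hβ] at hw' ⊢
  nlinarith

end Contact

section Contact

variable {E : Type*} [NormedAddCommGroup E] [InnerProductSpace ℝ E]

open scoped RealInnerProductSpace

/-- An upper semicontinuous function that is at most `c` almost everywhere is at most `c` at the
centre of the ball, provided that no quadratic function that is strongly concave in one direction
touches it from above. -/
theorem le_of_ae_le_of_not_touching [FiniteDimensional ℝ E] [MeasurableSpace E] [BorelSpace E]
    (μ : Measure E) [μ.IsAddHaarMeasure] {U : E → ℝ} {z₀ : E} {r A M c : ℝ}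
    (hr : 0 < r) (hA : 1 ≤ A)
    (husc : UpperSemicontinuousOn U (Metric.closedBall z₀ r))
    (hM : ∀ y ∈ Metric.closedBall z₀ r, U y ≤ M)
    (hnull : μ {y | y ∈ Metric.closedBall z₀ r ∧ c < U y} = 0)
    (hU : ∀ x ∈ Metric.ball z₀ r, ∀ e : E, ‖e‖ = 1 → ∀ a > 0, ∀ p : E,
      ¬ ∀ᶠ y in 𝓝 x, U y ≤ U x + ⟪p, y - x⟫ + a * ‖y - x‖ ^ 2 - A * a * ⟪e, y - x⟫ ^ 2) :
    U z₀ ≤ c := by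
  by_contra! hlt
  have hz₀ : z₀ ∈ Metric.closedBall z₀ r := Metric.mem_closedBall_self hr.le
  set d : ℝ := U z₀ - c with hd
  have hd0 : 0 < d := sub_pos.2 hlt
  set η : ℝ := d / (2 * r) with hη
  have hη0 : 0 < η := by positivity
  have hηr : η * r = d / 2 := by rw [hη]; field_simp
  set C : ℝ := 4 * (M - U z₀ + d) / r ^ 2 with hC
  have hMU := hM z₀ hz₀
  have hC0 : 0 < C := by
    rw [hC]
    have : 0 < M - U z₀ + d := by linarith
    positivity
  have hCr : C * (r / 2) ^ 2 = M - U z₀ + d := by rw [hC]; field_simp; ring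
  have key : ∀ p ∈ Metric.closedBall (0 : E) η, ∃ x, ‖x - z₀‖ ≤ r / 2 ∧ c < U x ∧
      ∀ z ∈ Metric.closedBall z₀ r,
        U z ≤ U x + C * (‖z - z₀‖ ^ 2 - ‖x - z₀‖ ^ 2) + ⟪p, z - x⟫ := by
    intro p hp
    rw [mem_closedBall_zero_iff] at hp
    have hG : UpperSemicontinuousOn (fun z => U z + -(C * ‖z - z₀‖ ^ 2 + ⟪p, z - z₀⟫))
        (Metric.closedBall z₀ r) :=
      husc.add (ContinuousOn.upperSemicontinuousOn (by fun_prop))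
    obtain ⟨x, hx, hmax⟩ := hG.exists_isMaxOn ⟨z₀, hz₀⟩ (isCompact_closedBall z₀ r)
    have h0 := hmax hz₀
    simp only [sub_self, norm_zero, inner_zero_right, Set.mem_ofPred_eq] at h0
    have hxn : ‖x - z₀‖ ≤ r := by simpa [dist_eq_norm] using hx
    have hin : |⟪p, x - z₀⟫| ≤ d / 2 := by
      rw [← hηr]
      exact (abs_real_inner_le_norm _ _).trans (by gcongr)
    have hin' := (abs_le.1 hin).1
    refine ⟨x, ?_, ?_, ?_⟩
    · have h1 : ‖x - z₀‖ ^ 2 ≤ (r / 2) ^ 2 := by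
        have := hM x hx
        refine le_of_mul_le_mul_left ?_ hC0
        rw [hCr]; linarith
      exact (abs_le_of_sq_le_sq' h1 (by positivity)).2
    · have : 0 ≤ C * ‖x - z₀‖ ^ 2 := by positivity
      linarith
    · intro z hz
      have h1 := hmax hz
      simp only [Set.mem_ofPred_eq] at h1
      have h2 : ⟪p, z - z₀⟫ = ⟪p, z - x⟫ + ⟪p, x - z₀⟫ := by
        rw [← inner_add_right]; congr 1; abel
      linarith
  choose! x hx1 hx2 hx3 using key
  set δ : ℝ := r / (2 * (20 * A + 2)) with hδ
  have hδ0 : 0 < δ := by positivity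
  have hball : ∀ p ∈ Metric.closedBall (0 : E) η, x p ∈ Metric.closedBall z₀ r := by
    intro p hp
    rw [mem_closedBall_iff_norm]
    linarith [hx1 p hp]
  have hclose : ∀ p ∈ Metric.closedBall (0 : E) η, ∀ q ∈ Metric.closedBall (0 : E) η,
      ∀ τ, ‖x p - x q‖ < τ → τ < δ → ‖p - q‖ ≤ 20 * A * C * τ := by
    intro p hp q hq τ h1 h2
    have hτ : 0 < τ := (norm_nonneg _).trans_lt h1
    refine slope_le_of_contact hC0 hA hτ husc hU ?_ (hball q hq) (hx3 p hp) (hx3 q hq) h1.le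
    intro z hz
    rw [mem_ball_iff_norm]
    have h3 : (20 * A + 2) * τ < (20 * A + 2) * δ := by gcongr
    have h4 : (20 * A + 2) * δ = r / 2 := by rw [hδ]; field_simp
    have h5 : ‖z - z₀‖ ≤ ‖z - x p‖ + ‖x p - z₀‖ := norm_sub_le_norm_sub_add_norm_sub _ _ _
    linarith [hx1 p hp]
  have hexp : ∀ p ∈ Metric.closedBall (0 : E) η, ∀ q ∈ Metric.closedBall (0 : E) η,
      ‖p - q‖ ≤ (20 * A * C + 2 * η / δ) * ‖x p - x q‖ := by
    intro p hp q hq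
    rcases lt_or_ge ‖x p - x q‖ δ with h | h
    · have h1 : ‖p - q‖ ≤ 20 * A * C * ‖x p - x q‖ := by
        have ht : Tendsto (fun τ : ℝ => 20 * A * C * τ) (𝓝[>] ‖x p - x q‖)
            (𝓝 (20 * A * C * ‖x p - x q‖)) :=
          (Continuous.tendsto (by fun_prop) _).mono_left nhdsWithin_le_nhds
        refine ge_of_tendsto ht ?_
        filter_upwards [Ioo_mem_nhdsGT h] with τ hτ using hclose p hp q hq τ hτ.1 hτ.2
      refine h1.trans ?_
      gcongr
      have : 0 ≤ 2 * η / δ := by positivity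
      linarith
    · have h1 : ‖p - q‖ ≤ 2 * η := by
        rw [mem_closedBall_zero_iff] at hp hq
        linarith [norm_sub_le p q]
      have h2 : 2 * η / δ * δ = 2 * η := by field_simp
      have h3 : 2 * η / δ * δ ≤ 2 * η / δ * ‖x p - x q‖ := by gcongr
      have h4 : 0 ≤ 20 * A * C * ‖x p - x q‖ := by positivity
      linarith
  have hzero := measure_eq_zero_of_antilipschitz μ (by positivity) hexp
    (measure_mono_null (by
      rintro _ ⟨p, hp, rfl⟩
      exact ⟨hball p hp, hx2 p hp⟩) hnull)
  exact (Metric.measure_closedBall_pos μ (0 : E) hη0).ne' hzero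

end Contact

section FourierSeries

open scoped RealInnerProductSpace FourierTransform SchwartzMap

/-- The fundamental-domain lift of a point of the torus. -/
def torusLift {N : ℕ} (t : UnitAddTorus (Fin N)) : EuclideanSpace ℝ (Fin N) :=
  WithLp.toLp 2 fun i => (AddCircle.equivIoc (1 : ℝ) (-(1 / 2)) (t i) : ℝ)

theorem torusLift_coe {N : ℕ} {y : Fin N → ℝ} (hy : ∀ i, y i ∈ Set.Ioc (-(1 / 2) : ℝ) (1 / 2)) :
    torusLift (fun i => (y i : UnitAddCircle)) = WithLp.toLp 2 y := by
  unfold torusLift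
  congr 1
  funext i
  apply AddCircle.equivIoc_coe_of_mem
  have := hy i
  rw [Set.mem_Ioc] at this ⊢
  constructor <;> linarith [this.1, this.2]

theorem abs_torusLift {N : ℕ} (t : UnitAddTorus (Fin N)) (i : Fin N) :
    |torusLift t i| = ‖t i‖ := by
  have h := (AddCircle.equivIoc (1 : ℝ) (-(1 / 2)) (t i)).2
  rw [Set.mem_Ioc] at h
  have h1 : |torusLift t i| ≤ |(1 : ℝ)| / 2 := by
    rw [abs_one, abs_le]
    exact ⟨h.1.le, by have := h.2; norm_num at this; simpa [torusLift] using this⟩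
  rw [← (AddCircle.norm_coe_eq_abs_iff (1 : ℝ) one_ne_zero).2 h1]
  simp [torusLift]

theorem continuous_comp_torusLift {N : ℕ} {f : EuclideanSpace ℝ (Fin N) → ℂ} (hf : Continuous f)
    {R : ℝ} (hR : R < 1 / 2) (hsupp : ∀ y, R < ‖y‖ → f y = 0) :
    Continuous fun t : UnitAddTorus (Fin N) => f (torusLift t) := by
  rw [continuous_iff_continuousAt]
  intro t
  by_cases ht : ∃ i, R < ‖t i‖
  · obtain ⟨i, hi⟩ := ht
    have hopen : ∀ᶠ s : UnitAddTorus (Fin N) in 𝓝 t, R < ‖s i‖ :=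
      ((continuous_apply i).norm.continuousAt).eventually (lt_mem_nhds hi)
    refine (continuousAt_const (y := (0 : ℂ))).congr ?_
    filter_upwards [hopen] with s hs
    refine (hsupp _ (hs.trans_le ?_)).symm
    rw [← abs_torusLift]
    exact PiLp.norm_apply_le (torusLift s) i
  · push Not at ht
    refine hf.continuousAt.comp ?_
    refine (PiLp.continuous_toLp 2 _).continuousAt.comp (continuousAt_pi.2 fun i => ?_)
    have hne : t i ≠ ((-(1 / 2) : ℝ) : UnitAddCircle) := by
      intro h
      have h2 := ht i
      rw [h, (AddCircle.norm_coe_eq_abs_iff (1 : ℝ) one_ne_zero).2 (by norm_num [abs_of_pos])] at h2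
      norm_num [abs_of_pos] at h2
      linarith
    exact continuous_subtype_val.continuousAt.comp
      (ContinuousAt.comp (f := fun s : UnitAddTorus (Fin N) => s i)
        (AddCircle.continuousAt_equivIoc (1 : ℝ) (-(1 / 2)) hne) (continuous_apply i).continuousAt)

theorem mFourier_coe {N : ℕ} (n : Fin N → ℤ) (y : Fin N → ℝ) :
    UnitAddTorus.mFourier n (fun i => (y i : UnitAddCircle)) =
      Complex.exp (((2 * Real.pi * ∑ i, n i * y i : ℝ) : ℂ) * Complex.I) := by
  simp only [UnitAddTorus.mFourier, ContinuousMap.coe_mk, fourier_coe_apply, ← Complex.exp_sum]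
  congr 1
  push_cast
  rw [Finset.mul_sum, Finset.sum_mul]
  refine Finset.sum_congr rfl fun i _ => ?_
  ring

theorem mFourierCoeff_comp_torusLift {N : ℕ} (f : 𝓢(EuclideanSpace ℝ (Fin N), ℂ))
    {R : ℝ} (hR : R < 1 / 2) (hsupp : ∀ y, R < ‖y‖ → f y = 0) (n : Fin N → ℤ) :
    UnitAddTorus.mFourierCoeff (fun t => f (torusLift t)) n =
      𝓕 f (WithLp.toLp 2 fun i => (n i : ℝ)) := by
  rw [UnitAddTorus.mFourierCoeff_eq_integral _ n (fun _ => -(1 / 2)), SchwartzMap.fourier_coe,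
    Real.fourier_eq', ← (PiLp.volume_preserving_toLp (Fin N)).integral_comp
      (MeasurableEquiv.toLp 2 (Fin N → ℝ)).measurableEmbedding,
    ← integral_indicator (by
      rw [Set.ofPred_forall]
      exact MeasurableSet.iInter fun i => measurableSet_Ioc.preimage (measurable_pi_apply i))]
  refine integral_congr_ae (Eventually.of_forall fun y => ?_)
  simp only [Set.indicator_apply, Set.mem_ofPred_eq]
  split_ifs with hy
  · have hy' : ∀ i, y i ∈ Set.Ioc (-(1 / 2) : ℝ) (1 / 2) := fun i => by
      have := hy i; norm_num at this ⊢; exact this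
    rw [torusLift_coe hy', mFourier_coe]
    congr 3
    simp [PiLp.inner_apply, mul_comm, Finset.mul_sum]
  · push Not at hy
    obtain ⟨i, hi⟩ := hy
    rw [hsupp, smul_zero]
    refine hR.trans_le (le_trans ?_ (PiLp.norm_apply_le (WithLp.toLp 2 y) i))
    rw [Real.norm_eq_abs]
    by_contra! hlt
    rw [abs_lt] at hlt
    exact hi ⟨hlt.1, by norm_num; exact hlt.2.le⟩

theorem summable_schwartz_int {N : ℕ} (g : 𝓢(EuclideanSpace ℝ (Fin N), ℂ)) :
    Summable fun n : Fin N → ℤ => g (WithLp.toLp 2 fun i => (n i : ℝ)) := by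
  set b := (EuclideanSpace.basisFun (Fin N) ℝ).toBasis with hb
  set L := Submodule.span ℤ (Set.range b) with hL
  set eq : L ≃ₗ[ℤ] (Fin N → ℤ) := (b.restrictScalars ℤ).equivFun with heq
  have hsum : Summable fun z : L => g z := by
    have h1 := ZLattice.summable_norm_pow_inv L (Module.finrank ℤ L + 1) (Nat.lt_succ_self _)
    obtain ⟨C, hC⟩ := g.decay (Module.finrank ℤ L + 1) 0
    refine Summable.of_norm_bounded_eventually (g := fun z : L => C * ‖z‖⁻¹ ^ (Module.finrank ℤ L + 1))
      (h1.mul_left C) ?_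
    have : ∀ᶠ z : L in cofinite, z ≠ 0 := by simp
    filter_upwards [this] with z hz
    have h0 : 0 < ‖z‖ := norm_pos_iff.2 hz
    have h2 := hC.2 z
    simp only [norm_iteratedFDeriv_zero] at h2
    rw [inv_pow, ← div_eq_mul_inv, le_div_iff₀ (by positivity), mul_comm]
    exact h2
  refine (eq.symm.toEquiv.summable_iff.2 hsum).congr fun n => ?_
  simp only [Function.comp]
  congr 1
  have : ((eq.symm n : L) : EuclideanSpace ℝ (Fin N)) = ∑ i, n i • b i := by
    rw [heq, Module.Basis.equivFun_symm_apply]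
    rw [AddSubmonoidClass.coe_finsetSum]
    refine Finset.sum_congr rfl fun i _ => ?_
    rw [Submodule.coe_smul, Module.Basis.restrictScalars_apply]
  simp only [LinearEquiv.coe_toEquiv]
  erw [this]
  ext j
  simp [hb, Finset.sum_apply, Pi.single_apply]

theorem hasSum_fourier_of_support {N : ℕ} (f : 𝓢(EuclideanSpace ℝ (Fin N), ℂ))
    {R : ℝ} (hR : R < 1 / 2) (hsupp : ∀ y, R < ‖y‖ → f y = 0) :
    ∃ B : (Fin N → ℤ) → ℂ, Summable B ∧ ∀ y : EuclideanSpace ℝ (Fin N), ‖y‖ < 1 / 2 →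
      HasSum (fun n => B n * Complex.exp (((2 * Real.pi * ∑ i, n i * y i : ℝ) : ℂ) * Complex.I))
        (f y) := by
  have hs : Summable (UnitAddTorus.mFourierCoeff fun t : UnitAddTorus (Fin N) => f (torusLift t)) := by
    simp_rw [funext (mFourierCoeff_comp_torusLift f hR hsupp)]
    exact summable_schwartz_int (𝓕 f)
  refine ⟨_, hs, fun y hy => ?_⟩
  have h := UnitAddTorus.hasSum_mFourier_series_apply_of_summable
    (f := ⟨_, continuous_comp_torusLift f.continuous hR hsupp⟩) hs
    (fun i => (y i : UnitAddCircle))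
  simp only [mFourier_coe, smul_eq_mul, ContinuousMap.coe_mk] at h
  rw [torusLift_coe] at h
  · exact h
  · intro i
    have := abs_lt.1 ((PiLp.norm_apply_le y i).trans_lt hy)
    exact ⟨this.1, this.2.le⟩

end FourierSeries

section AbsolutelySummable

/-- Absolutely summable complex families. -/
abbrev L1 (ι : Type*) := lp (fun _ : ι => ℂ) 1

variable {ι : Type*} {Y Z : Type*} [NormedAddCommGroup Y] [NormedSpace ℂ Y] [CompleteSpace Y]
  [NormedAddCommGroup Z] [NormedSpace ℂ Z]

theorem l1_hasSum_norm (c : L1 ι) : HasSum (fun k => ‖c k‖) ‖c‖ := by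
  simpa using lp.hasSum_norm (p := 1) (by simp) c

theorem l1_summable_smul (c : L1 ι) {w : ι → Y} {C : ℝ} (hw : ∀ k, ‖w k‖ ≤ C) :
    Summable fun k => c k • w k := by
  refine Summable.of_norm_bounded ((l1_hasSum_norm c).summable.mul_right C) fun k => ?_
  rw [norm_smul]
  exact mul_le_mul_of_nonneg_left (hw k) (norm_nonneg _)

/-- The continuous linear map on absolutely summable families with prescribed bounded values on
the unit vectors. -/
def l1Lift (w : ι → Y) (C : ℝ) (hw : ∀ k, ‖w k‖ ≤ C) : L1 ι →L[ℂ] Y :=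
  LinearMap.mkContinuous
    { toFun c := ∑' k, c k • w k
      map_add' c d := by
        rw [← (l1_summable_smul c hw).tsum_add (l1_summable_smul d hw)]
        exact tsum_congr fun k => by simp [add_smul]
      map_smul' a c := by
        rw [RingHom.id_apply, ← (l1_summable_smul c hw).tsum_const_smul]
        exact tsum_congr fun k => by simp [mul_smul] }
    C fun c => by
      refine (tsum_of_norm_bounded ((l1_hasSum_norm c).mul_left C) fun k => ?_)
      rw [norm_smul, mul_comm]
      exact mul_le_mul_of_nonneg_right (hw k) (norm_nonneg _)

theorem l1Lift_apply {w : ι → Y} {C : ℝ} (hw : ∀ k, ‖w k‖ ≤ C) (c : L1 ι) :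
    l1Lift w C hw c = ∑' k, c k • w k := rfl

theorem hasSum_l1Lift {w : ι → Y} {C : ℝ} (hw : ∀ k, ‖w k‖ ≤ C) (c : L1 ι) :
    HasSum (fun k => c k • w k) (l1Lift w C hw c) := (l1_summable_smul c hw).hasSum

theorem norm_l1Lift_le {w : ι → Y} {C : ℝ} (hw : ∀ k, ‖w k‖ ≤ C) (hC : 0 ≤ C) :
    ‖l1Lift w C hw‖ ≤ C := LinearMap.mkContinuous_norm_le _ hC _

open Classical in
/-- The unit vector at `k`. -/
def l1Delta (k : ι) : L1 ι := lp.single 1 k (1 : ℂ)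

theorem norm_l1Delta (k : ι) : ‖l1Delta k‖ = 1 := by
  simp [l1Delta, lp.norm_single]

theorem l1Lift_delta {w : ι → Y} {C : ℝ} (hw : ∀ k, ‖w k‖ ≤ C) (k : ι) :
    l1Lift w C hw (l1Delta k) = w k := by
  classical
  rw [l1Lift_apply, tsum_eq_single k]
  · simp [l1Delta]
  · intro j hj
    simp [l1Delta, lp.single_apply, Pi.single_eq_of_ne hj]

theorem l1_ext {S T : L1 ι →L[ℂ] Y} (h : ∀ k, S (l1Delta k) = T (l1Delta k)) : S = T := by
  classical
  refine lp.ext_continuousLinearMap (by simp) fun k => ?_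
  ext
  have := h k
  unfold l1Delta at this
  simp only [ContinuousLinearMap.comp_apply, lp.singleContinuousLinearMap_apply]
  convert this

theorem l1Lift_comp {w : ι → Y} {C : ℝ} (hw : ∀ k, ‖w k‖ ≤ C) (G : Y →L[ℂ] Z) (c : L1 ι) :
    HasSum (fun k => c k • G (w k)) (G (l1Lift w C hw c)) := by
  simpa using (hasSum_l1Lift hw c).mapL G

end AbsolutelySummable

section Characters

variable {V : Type*} [NormedAddCommGroup V] [NormedSpace ℝ V]

theorem norm_character (k : V →L[ℝ] ℝ) (v : V) : ‖Complex.exp ((k v : ℂ) * Complex.I)‖ ≤ 1 :=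
  (Complex.norm_exp_ofReal_mul_I _).le

/-- Evaluation at `v` of the almost periodic function with the given Fourier coefficients. -/
def l1Eval (v : V) : L1 (V →L[ℝ] ℝ) →L[ℂ] ℂ :=
  l1Lift (fun k => Complex.exp ((k v : ℂ) * Complex.I)) 1 fun k => norm_character k v

theorem l1Eval_delta (v : V) (k : V →L[ℝ] ℝ) :
    l1Eval v (l1Delta k) = Complex.exp ((k v : ℂ) * Complex.I) := l1Lift_delta _ _

/-- Translation of the frequencies by `m`. -/
def l1Shift (m : V →L[ℝ] ℝ) : L1 (V →L[ℝ] ℝ) →L[ℂ] L1 (V →L[ℝ] ℝ) :=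
  l1Lift (fun k => l1Delta (m + k)) 1 fun _ => (norm_l1Delta _).le

theorem norm_l1Shift_le (m : V →L[ℝ] ℝ) : ‖l1Shift m‖ ≤ 1 := norm_l1Lift_le _ zero_le_one

theorem l1Eval_shift (v : V) (m : V →L[ℝ] ℝ) (c : L1 (V →L[ℝ] ℝ)) :
    l1Eval v (l1Shift m c) = Complex.exp ((m v : ℂ) * Complex.I) * l1Eval v c := by
  have h : (l1Eval v).comp (l1Shift m) = Complex.exp ((m v : ℂ) * Complex.I) • l1Eval v := by
    refine l1_ext fun k => ?_
    simp only [ContinuousLinearMap.comp_apply, smul_apply, l1Shift,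
      l1Lift_delta, l1Eval_delta, smul_eq_mul, ← Complex.exp_add]
    congr 1
    simp [add_mul]
  exact DFunLike.congr_fun h c

/-- Convolution with `B`. -/
def l1Conv : L1 (V →L[ℝ] ℝ) →L[ℂ] L1 (V →L[ℝ] ℝ) →L[ℂ] L1 (V →L[ℝ] ℝ) :=
  l1Lift l1Shift 1 norm_l1Shift_le

theorem norm_l1Conv_le (B : L1 (V →L[ℝ] ℝ)) : ‖l1Conv B‖ ≤ ‖B‖ := by
  refine (l1Conv.le_opNorm B).trans ?_
  exact mul_le_of_le_one_left (norm_nonneg _) (norm_l1Lift_le _ zero_le_one)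

theorem l1Eval_conv (v : V) (B c : L1 (V →L[ℝ] ℝ)) :
    l1Eval v (l1Conv B c) = l1Eval v B * l1Eval v c := by
  have h : ((l1Eval v).comp ((ContinuousLinearMap.apply ℂ _ c).comp l1Conv)) =
      l1Eval v c • l1Eval v := by
    refine l1_ext fun k => ?_
    simp only [ContinuousLinearMap.comp_apply, smul_apply, l1Conv,
      l1Lift_delta, l1Eval_delta, smul_eq_mul, ContinuousLinearMap.apply_apply, l1Eval_shift]
    ring
  simpa [mul_comm] using DFunLike.congr_fun h B

/-- Multiplication of all frequencies by `t`. -/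
def l1Dilate (t : ℝ) : L1 (V →L[ℝ] ℝ) →L[ℂ] L1 (V →L[ℝ] ℝ) :=
  l1Lift (fun k => l1Delta (t • k)) 1 fun _ => (norm_l1Delta _).le

theorem norm_l1Dilate_le (t : ℝ) : ‖l1Dilate (V := V) t‖ ≤ 1 := norm_l1Lift_le _ zero_le_one

theorem l1Eval_dilate (v : V) (t : ℝ) (c : L1 (V →L[ℝ] ℝ)) :
    l1Eval v (l1Dilate t c) = l1Eval (t • v) c := by
  have h : (l1Eval v).comp (l1Dilate t) = l1Eval (t • v) := by
    refine l1_ext fun k => ?_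
    simp [l1Dilate, l1Lift_delta, l1Eval_delta]
  exact DFunLike.congr_fun h c

/-- On the ball of radius `ρ` the operator `P` acts as multiplication by `g`. -/
def Represents (ρ : ℝ) (g : V → ℂ) (P : L1 (V →L[ℝ] ℝ) →L[ℂ] L1 (V →L[ℝ] ℝ)) : Prop :=
  ∀ v, ‖v‖ < ρ → ∀ c, l1Eval v (P c) = g v * l1Eval v c

theorem Represents.pow {ρ : ℝ} {g : V → ℂ} {P : L1 (V →L[ℝ] ℝ) →L[ℂ] L1 (V →L[ℝ] ℝ)}
    (h : Represents ρ g P) (m : ℕ) : Represents ρ (fun v => g v ^ m) (P ^ m) := by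
  intro v hv
  induction m with
  | zero => simp
  | succ m ih =>
    intro c
    rw [pow_succ, mul_apply_eq_comp, ih, h v hv]
    ring

theorem norm_exp_sub_one_le {A : Type*} [NormedRing A] [NormedAlgebra ℂ A] [CompleteSpace A]
    (P : A) : ‖NormedSpace.exp P - 1‖ ≤ Real.exp ‖P‖ - 1 := by
  have h1 := (hasSum_nat_add_iff' 1).2 (NormedSpace.exp_series_hasSum_exp' (𝕂 := ℂ) P)
  have h2 := (hasSum_nat_add_iff' 1).2 (NormedSpace.exp_series_hasSum_exp' (𝕂 := ℝ) ‖P‖)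
  simp only [Finset.range_one, Finset.sum_singleton, Nat.factorial_zero, Nat.cast_one, inv_one,
    pow_zero, one_smul] at h1 h2
  rw [Real.exp_eq_exp_ℝ, ← h1.tsum_eq]
  refine tsum_of_norm_bounded h2 fun m => ?_
  rw [norm_smul, smul_eq_mul]
  refine mul_le_mul ?_ (norm_pow_le' _ (Nat.succ_pos m)) (norm_nonneg _) (by positivity)
  simp

theorem Represents.exp_sub_one {ρ : ℝ} {g : V → ℂ}
    {P : L1 (V →L[ℝ] ℝ) →L[ℂ] L1 (V →L[ℝ] ℝ)} (h : Represents ρ g P) :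
    Represents ρ (fun v => Complex.exp (g v) - 1) (NormedSpace.exp P - 1) := by
  intro v hv c
  have h1 := ((NormedSpace.exp_series_hasSum_exp' (𝕂 := ℂ) P).mapL
    (ContinuousLinearMap.apply ℂ (L1 (V →L[ℝ] ℝ)) c)).mapL (l1Eval v)
  have h2 := (NormedSpace.exp_series_hasSum_exp' (𝕂 := ℂ) (g v)).mul_right (l1Eval v c)
  have h3 := h1.unique (h2.congr_fun fun m => by
    have := h.pow m v hv c
    rw [map_smul, map_smul, ContinuousLinearMap.apply_apply, this]
    simp [mul_assoc])
  simp only [ContinuousLinearMap.apply_apply] at h3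
  rw [sub_apply, map_sub, h3, Complex.exp_eq_exp_ℂ]
  simp [sub_mul]

end Characters

section LocalExpansion

variable {V : Type*} [NormedAddCommGroup V] [NormedSpace ℝ V] [FiniteDimensional ℝ V]

/-- A smooth function agrees near each point with an absolutely convergent trigonometric series. -/
theorem exists_l1Eval_eq {f : V → ℂ} {s : Set V} (hs : IsOpen s)
    (hf : ContDiffOn ℝ ((⊤ : ℕ∞) : WithTop ℕ∞) f s) {x : V} (hx : x ∈ s) :
    ∃ r > 0, ∃ B : L1 (V →L[ℝ] ℝ), ∀ v, ‖v‖ < r → l1Eval v B = f (x + v) := by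
  set T : V ≃L[ℝ] EuclideanSpace ℝ (Fin (Module.finrank ℝ V)) := toEuclidean with hT
  obtain ⟨t, ht0, ht⟩ : ∃ t : ℝ, 0 < t ∧ ∀ y, ‖y‖ < 1 → x + t • T.symm y ∈ s := by
    obtain ⟨δ, hδ, hδs⟩ := Metric.isOpen_iff.1 hs x hx
    let S := T.symm.toContinuousLinearMap
    have hpos : 0 < ‖S‖ + 1 := by positivity
    refine ⟨δ / (‖S‖ + 1), by positivity, fun y hy => hδs ?_⟩
    rw [Metric.mem_ball, dist_eq_norm, add_sub_cancel_left, norm_smul, Real.norm_eq_abs,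
      abs_of_pos (by positivity), div_mul_eq_mul_div, div_lt_iff₀ hpos]
    refine mul_lt_mul_of_pos_left ?_ hδ
    have : ‖T.symm y‖ ≤ ‖S‖ * ‖y‖ := S.le_opNorm y
    have h2 : ‖S‖ * ‖y‖ ≤ ‖S‖ * 1 :=
      mul_le_mul_of_nonneg_left hy.le (norm_nonneg _)
    linarith
  let χ : ContDiffBump (0 : EuclideanSpace ℝ (Fin (Module.finrank ℝ V))) :=
    ⟨1 / 8, 1 / 4, by norm_num, by norm_num⟩
  set g : EuclideanSpace ℝ (Fin (Module.finrank ℝ V)) → ℂ :=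
    fun y => χ y • f (x + t • T.symm y) with hg
  have hcs : HasCompactSupport g := χ.hasCompactSupport.smul_right
  have hsmooth : ContDiff ℝ ((⊤ : ℕ∞) : WithTop ℕ∞) g := by
    rw [contDiff_iff_contDiffAt]
    intro y
    by_cases hy : y ∉ tsupport g
    · exact contDiffAt_const.congr_of_eventuallyEq (notMem_tsupport_iff_eventuallyEq.1 hy)
    rw [not_not] at hy
    have hy' : y ∈ tsupport χ := (tsupport_smul_subset_left (χ : _ → ℝ) _) hy
    rw [χ.tsupport_eq, mem_closedBall_zero_iff] at hy'
    have hys : x + t • T.symm y ∈ s := ht y (hy'.trans_lt (by norm_num))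
    refine χ.contDiff.contDiffAt.smul ?_
    refine ContDiffAt.comp (g := f) y (hf.contDiffAt (hs.mem_nhds hys)) ?_
    exact contDiffAt_const.add (contDiffAt_const.smul T.symm.contDiff.contDiffAt)
  obtain ⟨B, hB, hBsum⟩ := hasSum_fourier_of_support (hcs.toSchwartzMap hsmooth)
    (R := 1 / 4) (by norm_num) fun y hy => by
      have : χ y = 0 := χ.zero_of_le_dist (by rw [dist_zero_right]; exact hy.le)
      simp [hg, this]
  let κ : (Fin (Module.finrank ℝ V) → ℤ) → V →L[ℝ] ℝ := fun n =>
    (2 * Real.pi) • ∑ i, (n i : ℝ) •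
      ((EuclideanSpace.proj i : _ →L[ℝ] ℝ).comp (t⁻¹ • (T : V →L[ℝ] _)))
  have hmem : Memℓp B 1 := memℓp_gen (by simpa using hB.norm)
  have hcont : ∀ᶠ v : V in 𝓝 0, ‖t⁻¹ • T v‖ < 1 / 8 := by
    have : ContinuousAt (fun v : V => ‖t⁻¹ • T v‖) 0 := by fun_prop
    exact this.eventually (gt_mem_nhds (by simp))
  obtain ⟨r, hr, hrv⟩ := Metric.eventually_nhds_iff_ball.1 hcont
  refine ⟨r, hr, l1Lift (fun n => l1Delta (κ n)) 1 (fun _ => (norm_l1Delta _).le) ⟨B, hmem⟩,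
    fun v hv => ?_⟩
  have hy := hrv v (by simpa using hv)
  refine (l1Lift_comp _ (l1Eval v) _).unique ?_
  have h1 := hBsum (t⁻¹ • T v) (hy.trans (by norm_num))
  have h2 : g (t⁻¹ • T v) = f (x + v) := by
    have : χ (t⁻¹ • T v) = 1 := χ.one_of_mem_closedBall (by
      rw [mem_closedBall_zero_iff]; exact hy.le)
    simp only [hg, this, one_smul, map_smul, ContinuousLinearEquiv.symm_apply_apply,
      smul_inv_smul₀ ht0.ne']
  change HasSum _ (g (t⁻¹ • T v)) at h1
  rw [h2] at h1
  refine h1.congr_fun fun n => ?_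
  rw [l1Eval_delta, smul_eq_mul]
  simp [κ]

end LocalExpansion

section SmallOperators

variable {V : Type*} [NormedAddCommGroup V] [NormedSpace ℝ V] [FiniteDimensional ℝ V]

theorem exists_represents_linear (k : V →L[ℝ] ℝ) : ∃ C, ∀ ρ > 0,
    ∃ P, Represents ρ (fun v => (k v : ℂ)) P ∧ ‖P‖ ≤ C * ρ := by
  obtain ⟨r, hr, B, hB⟩ := exists_l1Eval_eq (f := fun v => (k v : ℂ)) (x := (0 : V)) isOpen_univ
    (Complex.ofRealCLM.contDiff.comp k.contDiff).contDiffOn (Set.mem_univ _)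
  refine ⟨r⁻¹ * ‖B‖, fun ρ hρ => ⟨((ρ / r : ℝ) : ℂ) • l1Conv (l1Dilate (r / ρ) B), ?_, ?_⟩⟩
  · intro v hv c
    have hvr : ‖(r / ρ) • v‖ < r := by
      rw [norm_smul, Real.norm_eq_abs, abs_of_pos (by positivity), div_mul_eq_mul_div,
        div_lt_iff₀ hρ]
      exact mul_lt_mul_of_pos_left hv hr
    rw [smul_apply, map_smul, l1Eval_conv, l1Eval_dilate, hB _ hvr, zero_add,
      map_smul, smul_eq_mul, smul_eq_mul, ← mul_assoc]
    congr 1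
    push_cast
    have h1 : (r : ℂ) ≠ 0 := by exact_mod_cast hr.ne'
    have h2 : (ρ : ℂ) ≠ 0 := by exact_mod_cast hρ.ne'
    field_simp
  · rw [norm_smul, Complex.norm_real, Real.norm_eq_abs, abs_of_pos (by positivity)]
    have h1 : ‖l1Conv (l1Dilate (r / ρ) B)‖ ≤ ‖B‖ := (norm_l1Conv_le _).trans
      (((l1Dilate _).le_opNorm B).trans
        (mul_le_of_le_one_left (norm_nonneg _) (norm_l1Dilate_le _)))
    calc ρ / r * ‖l1Conv (l1Dilate (r / ρ) B)‖ ≤ ρ / r * ‖B‖ := by gcongr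
      _ = r⁻¹ * ‖B‖ * ρ := by ring

theorem exists_represents_character (k : V →L[ℝ] ℝ) : ∃ δ : ℝ → ℝ, Tendsto δ (𝓝[>] 0) (𝓝 0) ∧
    ∀ ρ > 0, ∃ P, Represents ρ (fun v => Complex.exp ((k v : ℂ) * Complex.I) - 1) P ∧
      ‖P‖ ≤ δ ρ ∧ ‖P‖ ≤ 2 := by
  obtain ⟨C, hC⟩ := exists_represents_linear k
  refine ⟨fun ρ => Real.exp (C * ρ) - 1, ?_, fun ρ hρ => ?_⟩
  · have : Continuous fun ρ : ℝ => Real.exp (C * ρ) - 1 := by fun_prop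
    simpa using (this.tendsto 0).mono_left nhdsWithin_le_nhds
  · by_cases hsmall : Real.exp (C * ρ) - 1 ≤ 2
    · obtain ⟨P, hP, hPn⟩ := hC ρ hρ
      have hR : Represents ρ (fun v => (k v : ℂ) * Complex.I) (Complex.I • P) := by
        intro v hv c
        rw [smul_apply, map_smul, hP v hv, smul_eq_mul]
        ring
      have hn : ‖NormedSpace.exp (Complex.I • P) - 1‖ ≤ Real.exp (C * ρ) - 1 := by
        refine (norm_exp_sub_one_le _).trans ?_
        rw [norm_smul, Complex.norm_I, one_mul]
        gcongr
      exact ⟨_, hR.exp_sub_one, hn, hn.trans hsmall⟩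
    · have hn : ‖l1Shift k - 1‖ ≤ 2 := by
        refine (norm_sub_le _ _).trans ?_
        have h1 := norm_l1Shift_le k
        have h2 : ‖(1 : L1 (V →L[ℝ] ℝ) →L[ℂ] L1 (V →L[ℝ] ℝ))‖ ≤ 1 := ContinuousLinearMap.norm_id_le
        linarith
      refine ⟨l1Shift k - 1, fun v _ c => ?_, hn.trans (not_le.1 hsmall).le, hn⟩
      rw [sub_apply, map_sub, l1Eval_shift]
      simp [sub_mul]

/-- Multiplication by a smooth function vanishing at `x` is represented near `x` by operators of
arbitrarily small norm. -/
theorem eventually_exists_represents {f : V → ℂ} {s : Set V} (hs : IsOpen s)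
    (hf : ContDiffOn ℝ ((⊤ : ℕ∞) : WithTop ℕ∞) f s) {x : V} (hx : x ∈ s) (hfx : f x = 0)
    {ε : ℝ} (hε : 0 < ε) :
    ∀ᶠ ρ in 𝓝[>] (0 : ℝ), ∃ P, Represents ρ (fun v => f (x + v)) P ∧ ‖P‖ ≤ ε := by
  obtain ⟨r, hr, B, hB⟩ := exists_l1Eval_eq hs hf hx
  choose δ hδ hP using fun k : V →L[ℝ] ℝ => exists_represents_character k
  have hlim : Tendsto (fun ρ => ∑' k, ‖B k‖ * max 0 (min (δ k ρ) 2)) (𝓝[>] (0 : ℝ)) (𝓝 0) := by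
    have := tendsto_tsum_of_dominated_convergence (𝓕 := 𝓝[>] (0 : ℝ))
      (f := fun ρ k => ‖B k‖ * max 0 (min (δ k ρ) 2)) (g := fun _ => 0)
      (bound := fun k => ‖B k‖ * 2) ((l1_hasSum_norm B).summable.mul_right 2) (fun k => ?_) ?_
    · simpa using this
    · have h1 : Tendsto (fun ρ => max 0 (min (δ k ρ) 2)) (𝓝[>] (0 : ℝ)) (𝓝 (max 0 (min 0 2))) :=
        tendsto_const_nhds.max ((hδ k).min tendsto_const_nhds)
      simpa using h1.const_mul ‖B k‖
    · refine Eventually.of_forall fun ρ k => ?_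
      rw [norm_mul, norm_norm, Real.norm_eq_abs, abs_of_nonneg (le_max_left _ _)]
      gcongr
      exact max_le (by norm_num) (min_le_right _ _)
  have hrev : ∀ᶠ ρ in 𝓝[>] (0 : ℝ), ρ < r := mem_nhdsWithin_of_mem_nhds (gt_mem_nhds hr)
  filter_upwards [hlim.eventually (gt_mem_nhds hε), hrev, self_mem_nhdsWithin]
    with ρ hρε hρr hρ0
  choose P hPrep hPδ hP2 using fun k => hP k ρ hρ0
  refine ⟨l1Lift P 2 hP2 B, fun v hv c => ?_, ?_⟩
  · have h1 := (l1Lift_comp hP2 (ContinuousLinearMap.apply ℂ _ c) B).mapL (l1Eval v)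
    simp only [ContinuousLinearMap.apply_apply, map_smul, hPrep _ v hv] at h1
    have h2 : ∀ w : V, HasSum (fun k => B k • Complex.exp ((k w : ℂ) * Complex.I)) (l1Eval w B) :=
      fun w => hasSum_l1Lift _ B
    have h3 := (((h2 v).sub (h2 0)).mul_right (l1Eval v c))
    rw [hB v (hv.trans hρr), hB 0 (by simpa using hr), add_zero, hfx, sub_zero] at h3
    refine h1.unique (h3.congr_fun fun k => ?_)
    simp only [map_zero, Complex.ofReal_zero, zero_mul, Complex.exp_zero, smul_eq_mul]
    ring
  · refine le_trans ?_ hρε.le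
    have hsum : Summable fun k => ‖B k‖ * max 0 (min (δ k ρ) 2) :=
      Summable.of_nonneg_of_le (fun k => by positivity)
        (fun k => mul_le_mul_of_nonneg_left (max_le (by norm_num) (min_le_right _ _))
          (norm_nonneg _)) ((l1_hasSum_norm B).summable.mul_right 2)
    refine tsum_of_norm_bounded hsum.hasSum fun k => ?_
    rw [norm_smul]
    gcongr
    exact le_max_of_le_right (le_min (hPδ k) (hP2 k))

end SmallOperators

section MixedPart

variable {n : ℕ}

/-- The `∂_i ∂̄_j` component of a real bilinear form. -/
def mixedPart (F : Cz n → Cz n → ℂ) (i j : Fin n) : ℂ :=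
  (F (Pi.single i 1) (Pi.single j 1) + Complex.I * F (Pi.single i 1) (Pi.single j Complex.I)
    - Complex.I * F (Pi.single i Complex.I) (Pi.single j 1)
    + F (Pi.single i Complex.I) (Pi.single j Complex.I)) / 4

/-- The contraction of the mixed part of a real bilinear form with a matrix. -/
def mixedTrace (W : Matrix (Fin n) (Fin n) ℂ) (F : Cz n → Cz n → ℂ) : ℂ :=
  ∑ i, ∑ j, W i j * mixedPart F i j

theorem mixedPart_add (F G : Cz n → Cz n → ℂ) (i j : Fin n) :
    mixedPart (fun a b => F a b + G a b) i j = mixedPart F i j + mixedPart G i j := by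
  unfold mixedPart; ring

theorem mixedPart_mul (t : ℂ) (F : Cz n → Cz n → ℂ) (i j : Fin n) :
    mixedPart (fun a b => t * F a b) i j = t * mixedPart F i j := by
  unfold mixedPart; ring

theorem mixedTrace_add (W : Matrix (Fin n) (Fin n) ℂ) (F G : Cz n → Cz n → ℂ) :
    mixedTrace W (fun a b => F a b + G a b) = mixedTrace W F + mixedTrace W G := by
  simp only [mixedTrace, mixedPart_add, mul_add, Finset.sum_add_distrib]

theorem mixedTrace_mul (W : Matrix (Fin n) (Fin n) ℂ) (t : ℂ) (F : Cz n → Cz n → ℂ) :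
    mixedTrace W (fun a b => t * F a b) = t * mixedTrace W F := by
  simp only [mixedTrace, mixedPart_mul, Finset.mul_sum]
  exact Finset.sum_congr rfl fun i _ => Finset.sum_congr rfl fun j _ => by ring

theorem mixedTrace_sum {ι : Type*} (s : Finset ι) (W : Matrix (Fin n) (Fin n) ℂ)
    (F : ι → Cz n → Cz n → ℂ) :
    mixedTrace W (fun a b => ∑ m ∈ s, F m a b) = ∑ m ∈ s, mixedTrace W (F m) := by
  classical
  induction s using Finset.induction_on with
  | empty => simp [mixedTrace, mixedPart]
  | insert m s hm ih => simp only [Finset.sum_insert hm, mixedTrace_add, ih]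

theorem mixedTrace_conj {W : Matrix (Fin n) (Fin n) ℂ} (hW : W.IsHermitian)
    {F : Cz n → Cz n → ℂ} (hF : ∀ a b, F a b = F b a) :
    mixedTrace W (fun a b => (starRingEnd ℂ) (F a b)) = (starRingEnd ℂ) (mixedTrace W F) := by
  have h1 : ∀ i j, mixedPart (fun a b => (starRingEnd ℂ) (F a b)) i j =
      (starRingEnd ℂ) (mixedPart F j i) := by
    intro i j
    simp only [mixedPart, map_div₀, map_add, map_sub, map_mul, Complex.conj_I, map_ofNat]
    rw [hF (Pi.single j 1) (Pi.single i 1), hF (Pi.single j 1) (Pi.single i Complex.I),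
      hF (Pi.single j Complex.I) (Pi.single i 1),
      hF (Pi.single j Complex.I) (Pi.single i Complex.I)]
    ring
  simp only [mixedTrace, map_sum, map_mul, h1]
  rw [Finset.sum_comm]
  refine Finset.sum_congr rfl fun j _ => Finset.sum_congr rfl fun i _ => ?_
  rw [← hW.apply i j]
  rfl

theorem mixedTrace_re {W : Matrix (Fin n) (Fin n) ℂ} (hW : W.IsHermitian)
    {F : Cz n → Cz n → ℂ} (hF : ∀ a b, F a b = F b a) :
    mixedTrace W (fun a b => ((F a b).re : ℂ)) = ((mixedTrace W F).re : ℂ) := by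
  rw [Complex.re_eq_add_conj, ← mixedTrace_conj hW hF, ← mixedTrace_add]
  have : (fun a b => ((F a b).re : ℂ)) =
      fun a b => (1 / 2 : ℂ) * (F a b + (starRingEnd ℂ) (F a b)) := by
    funext a b
    rw [Complex.re_eq_add_conj]
    ring
  rw [this, mixedTrace_mul]
  ring

theorem norm_mixedPart_le {F : Cz n → Cz n → ℂ} {C : ℝ} (hF : ∀ a b, ‖F a b‖ ≤ C * ‖a‖ * ‖b‖)
    (i j : Fin n) : ‖mixedPart F i j‖ ≤ C := by
  have h : ∀ a b : ℂ, ‖a‖ = 1 → ‖b‖ = 1 → ‖F (Pi.single i a) (Pi.single j b)‖ ≤ C := by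
    intro a b ha hb
    refine (hF _ _).trans ?_
    rw [Pi.norm_single, Pi.norm_single, ha, hb, mul_one, mul_one]
  have hI : ‖Complex.I‖ = 1 := Complex.norm_I
  have h1 : ‖(1 : ℂ)‖ = 1 := norm_one
  unfold mixedPart
  rw [norm_div, div_le_iff₀ (by simp)]
  refine (norm_add_le _ _).trans ?_
  have e1 := norm_sub_le (F (Pi.single i 1) (Pi.single j 1)
    + Complex.I * F (Pi.single i 1) (Pi.single j Complex.I))
    (Complex.I * F (Pi.single i Complex.I) (Pi.single j 1))
  have e2 := norm_add_le (F (Pi.single i 1) (Pi.single j 1))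
    (Complex.I * F (Pi.single i 1) (Pi.single j Complex.I))
  rw [norm_mul, hI, one_mul] at e1 e2
  have := h 1 1 h1 h1
  have := h 1 Complex.I h1 hI
  have := h Complex.I 1 hI h1
  have := h Complex.I Complex.I hI hI
  norm_num
  linarith

/-- The quadratic form on covectors given by the symbol of the operator. -/
def symbol (W : Matrix (Fin n) (Fin n) ℂ) (k : Cz n →L[ℝ] ℝ) : ℝ :=
  (mixedTrace W fun a b => (k a * k b : ℂ)).re

theorem mixedTrace_covector {W : Matrix (Fin n) (Fin n) ℂ} (hW : W.IsHermitian)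
    (k : Cz n →L[ℝ] ℝ) : mixedTrace W (fun a b => (k a * k b : ℂ)) = symbol W k := by
  rw [symbol, ← mixedTrace_re hW fun a b => mul_comm _ _]
  congr 1
  funext a b
  rw [← Complex.ofReal_mul, Complex.ofReal_re]

theorem symbol_pos {W : Matrix (Fin n) (Fin n) ℂ} (hW : W.PosDef) {k : Cz n →L[ℝ] ℝ}
    (hk : k ≠ 0) : 0 < symbol W k := by
  set y : Fin n → ℂ := fun i => k (Pi.single i 1) + Complex.I * k (Pi.single i Complex.I) with hy
  have hy0 : y ≠ 0 := by
    intro h0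
    apply hk
    have hz : ∀ i, k (Pi.single i 1) = 0 ∧ k (Pi.single i Complex.I) = 0 := by
      intro i
      have := congrFun h0 i
      simp only [hy, Pi.zero_apply] at this
      constructor
      · simpa using congrArg Complex.re this
      · simpa using congrArg Complex.im this
    ext v
    have hv : v = ∑ i, ((v i).re • (Pi.single i 1 : Cz n) + (v i).im • (Pi.single i Complex.I : Cz n)) := by
      ext j
      simp [Finset.sum_apply, Pi.single_apply, Finset.sum_add_distrib]
    rw [hv, map_sum]
    simp [(hz _).1, (hz _).2]
  have h := hW.dotProduct_mulVec_pos hy0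
  have h2 : star y ⬝ᵥ W.mulVec y = 4 * mixedTrace W fun a b => (k a * k b : ℂ) := by
    simp only [dotProduct, Matrix.mulVec, mixedTrace, mixedPart, Finset.mul_sum]
    refine Finset.sum_congr rfl fun i _ => Finset.sum_congr rfl fun j _ => ?_
    simp only [hy, Pi.star_apply, star_add, star_mul', Complex.star_def, Complex.conj_I,
      Complex.conj_ofReal]
    ring_nf
    simp only [Complex.I_sq]
    ring
  rw [h2, mixedTrace_covector hW.isHermitian] at h
  have h3 : (0 : ℝ) < 4 * symbol W k := by exact_mod_cast h
  linarith

theorem symbol_smul (W : Matrix (Fin n) (Fin n) ℂ) (t : ℝ) (k : Cz n →L[ℝ] ℝ) :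
    symbol W (t • k) = t ^ 2 * symbol W k := by
  have : (fun a b => (((t • k) a : ℝ) * ((t • k) b : ℝ) : ℂ)) =
      fun a b => ((t ^ 2 : ℝ) : ℂ) * (k a * k b : ℂ) := by
    funext a b
    simp only [FunLike.coe_smul, Pi.smul_apply, smul_eq_mul]
    push_cast
    ring
  rw [symbol, this, mixedTrace_mul, Complex.re_ofReal_mul, symbol]

/-- Uniform ellipticity on compact sets. -/
theorem exists_symbol_bounds {W : Cz n → Matrix (Fin n) (Fin n) ℂ} {K : Set (Cz n)}
    (hK : IsCompact K) (hcont : ∀ i j, ContinuousOn (fun z => W z i j) K)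
    (hpos : ∀ z ∈ K, (W z).PosDef) :
    ∃ q₀ > 0, ∃ q₁ > 0, ∀ z ∈ K, ∀ k : Cz n →L[ℝ] ℝ,
      q₀ * ‖k‖ ^ 2 ≤ symbol (W z) k ∧ symbol (W z) k ≤ q₁ * ‖k‖ ^ 2 := by
  set S : Set (Cz n × (Cz n →L[ℝ] ℝ)) := K ×ˢ Metric.sphere 0 1 with hS
  have hSc : IsCompact S := hK.prod (isCompact_sphere _ _)
  have hQ : ContinuousOn (fun q : Cz n × (Cz n →L[ℝ] ℝ) => symbol (W q.1) q.2) S := by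
    unfold symbol mixedTrace
    refine Complex.continuous_re.comp_continuousOn ?_
    refine continuousOn_finsetSum _ fun i _ => continuousOn_finsetSum _ fun j _ => ?_
    refine ((hcont i j).comp continuousOn_fst fun q hq => hq.1).mul ?_
    unfold mixedPart
    fun_prop
  have hne : ∀ q ∈ S, q.2 ≠ 0 := by
    rintro ⟨z, k⟩ ⟨_, hk⟩ h0
    simp only at h0
    simp [h0] at hk
  have hred : ∀ q₀ q₁ : ℝ, (∀ q ∈ S, q₀ ≤ symbol (W q.1) q.2 ∧ symbol (W q.1) q.2 ≤ q₁) →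
      ∀ z ∈ K, ∀ k : Cz n →L[ℝ] ℝ,
        q₀ * ‖k‖ ^ 2 ≤ symbol (W z) k ∧ symbol (W z) k ≤ q₁ * ‖k‖ ^ 2 := by
    intro q₀ q₁ hq z hz k
    rcases eq_or_ne k 0 with rfl | hk
    · simp [symbol, mixedTrace, mixedPart]
    have hkn : 0 < ‖k‖ := norm_pos_iff.2 hk
    have h1 := hq (z, ‖k‖⁻¹ • k) ⟨hz, by simp [norm_smul, hkn.ne']⟩
    have h2 : symbol (W z) k = ‖k‖ ^ 2 * symbol (W z) (‖k‖⁻¹ • k) := by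
      rw [← symbol_smul, smul_inv_smul₀ hkn.ne']
    rw [h2]
    constructor <;> nlinarith [h1.1, h1.2, sq_nonneg ‖k‖]
  rcases S.eq_empty_or_nonempty with hem | hSn
  · exact ⟨1, one_pos, 1, one_pos, hred 1 1 (by simp [hem])⟩
  obtain ⟨a, ha, hamin⟩ := hSc.exists_isMinOn hSn hQ
  obtain ⟨b, hb, hbmax⟩ := hSc.exists_isMaxOn hSn hQ
  exact ⟨_, symbol_pos (hpos _ ha.1) (hne a ha), _, symbol_pos (hpos _ hb.1) (hne b hb),
    hred _ _ fun q hq => ⟨hamin hq, hbmax hq⟩⟩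

theorem cHess_eq_mixedPart {h : Cz n → ℝ} {G : Cz n → Cz n →L[ℝ] ℝ}
    {H : Cz n →L[ℝ] Cz n →L[ℝ] ℝ} {z : Cz n} (hG : ∀ᶠ w in 𝓝 z, HasFDerivAt h (G w) w)
    (hH : HasFDerivAt G H z) (i j : Fin n) :
    cHess h i j z = mixedPart (fun a b => (H a b : ℂ)) i j := by
  have h1 : wderBar j (fun w => (h w : ℂ)) =ᶠ[𝓝 z]
      fun w => ((G w (Pi.single j 1) : ℂ) + Complex.I * (G w (Pi.single j Complex.I) : ℂ)) / 2 := by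
    filter_upwards [hG] with w hw
    have : HasFDerivAt (fun w => (h w : ℂ)) (Complex.ofRealCLM.comp (G w)) w :=
      Complex.ofRealCLM.hasFDerivAt.comp w hw
    rw [wderBar, this.fderiv]
    simp
  have h2 : ∀ b : Cz n, HasFDerivAt (fun w => (G w b : ℂ))
      (Complex.ofRealCLM.comp ((ContinuousLinearMap.apply ℝ ℝ b).comp H)) z := fun b =>
    Complex.ofRealCLM.hasFDerivAt.comp z
      ((ContinuousLinearMap.apply ℝ ℝ b).hasFDerivAt.comp z hH)
  have h3 := ((h2 (Pi.single j 1)).add ((h2 (Pi.single j Complex.I)).const_mul Complex.I)).mul_const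
    (2⁻¹ : ℂ)
  rw [cHess, cHessC, wder, (h3.congr_of_eventuallyEq h1).fderiv, mixedPart]
  simp
  ring_nf
  simp only [Complex.I_sq]
  ring

end MixedPart

section SecondOrderSeries

variable {ι V : Type*} [NormedAddCommGroup V] [NormedSpace ℝ V]

theorem contDiff_two_of_hasFDerivAt {F : Type*} [NormedAddCommGroup F] [NormedSpace ℝ F]
    {w : V → F} {G : V → V →L[ℝ] F} {H : V → V →L[ℝ] V →L[ℝ] F}
    (hG : ∀ v, HasFDerivAt w (G v) v) (hH : ∀ v, HasFDerivAt G (H v) v) (hc : Continuous H) :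
    ContDiff ℝ 2 w := by
  have h1 : fderiv ℝ w = G := funext fun v => (hG v).fderiv
  have h2 : fderiv ℝ G = H := funext fun v => (hH v).fderiv
  have h3 : ContDiff ℝ 1 G :=
    contDiff_one_iff_fderiv.2 ⟨fun v => (hH v).differentiableAt, h2 ▸ hc⟩
  rw [show (2 : WithTop ℕ∞) = 1 + 1 by norm_num, contDiff_succ_iff_fderiv]
  exact ⟨fun v => (hG v).differentiableAt, by simp, h1 ▸ h3⟩

/-- Termwise second-order differentiation of an absolutely summable combination of functions that
vanish to second order at the origin and have uniformly bounded second derivatives. -/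
theorem tsum_second_order {ψ : ι → V → ℂ} {ψ' : ι → V → V →L[ℝ] ℂ}
    {ψ'' : ι → V → V →L[ℝ] V →L[ℝ] ℂ} {C : ℝ}
    (h₁ : ∀ k v, HasFDerivAt (ψ k) (ψ' k v) v) (h₂ : ∀ k v, HasFDerivAt (ψ' k) (ψ'' k v) v)
    (h₀ : ∀ k, ψ k 0 = 0) (h₀' : ∀ k, ψ' k 0 = 0) (hC : ∀ k v, ‖ψ'' k v‖ ≤ C)
    (hcont : ∀ k, Continuous (ψ'' k)) (c : L1 ι) :
    ∃ G : V → V →L[ℝ] ℂ, (∀ v, HasFDerivAt (fun v => ∑' k, c k • ψ k v) (G v) v) ∧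
      (∀ v, HasFDerivAt G (∑' k, c k • ψ'' k v) v) ∧
      Continuous (fun v => ∑' k, c k • ψ'' k v) ∧
      ∀ v, ‖∑' k, c k • ψ k v‖ ≤ C * ‖c‖ * ‖v‖ ^ 2 := by
  have hb' : ∀ k v, ‖ψ' k v‖ ≤ C * ‖v‖ := by
    intro k v
    have := convex_univ.norm_image_sub_le_of_norm_hasFDerivWithin_le
      (fun y _ => (h₂ k y).hasFDerivWithinAt) (fun y _ => hC k y) (Set.mem_univ 0) (Set.mem_univ v)
    simpa [h₀'] using this
  have hC0 : ∀ _ : ι, 0 ≤ C := fun k => (norm_nonneg (ψ'' k 0)).trans (hC k 0)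
  have hb : ∀ k v, ‖ψ k v‖ ≤ C * ‖v‖ ^ 2 := by
    intro k v
    have := (convex_closedBall (0 : V) ‖v‖).norm_image_sub_le_of_norm_hasFDerivWithin_le
      (fun y _ => (h₁ k y).hasFDerivWithinAt) (C := C * ‖v‖) (fun y hy => (hb' k y).trans
        (mul_le_mul_of_nonneg_left (by simpa using hy) (hC0 k)))
      (x := 0) (y := v) (by simp) (by simp)
    simpa [h₀, pow_two, mul_assoc] using this
  have hsc : Summable fun k => ‖c k‖ := (l1_hasSum_norm c).summable
  have hsmul : ∀ k v, ‖c k • ψ'' k v‖ ≤ ‖c k‖ * C := fun k v =>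
    (ContinuousLinearMap.opNorm_smul_le (c k) (ψ'' k v)).trans
      (mul_le_mul_of_nonneg_left (hC k v) (norm_nonneg _))
  refine ⟨fun v => ∑' k, c k • ψ' k v, fun v => ?_, fun v => ?_, ?_, fun v => ?_⟩
  · refine hasFDerivAt_tsum_of_isPreconnected (u := fun k => ‖c k‖ * (C * (‖v‖ + 1)))
      (s := Metric.ball 0 (‖v‖ + 1)) (x₀ := 0) (hsc.mul_right _) Metric.isOpen_ball
      (convex_ball _ _).isPreconnected (fun k y _ => (h₁ k y).const_smul (c k)) ?_
      (Metric.mem_ball_self (by positivity)) ?_ (by simp)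
    · intro k y hy
      rw [norm_smul]
      refine mul_le_mul_of_nonneg_left ((hb' k y).trans ?_) (norm_nonneg _)
      refine mul_le_mul_of_nonneg_left ?_ (hC0 k)
      simpa using (mem_ball_zero_iff.1 hy).le
    · simp [h₀]
  · refine hasFDerivAt_tsum (u := fun k => ‖c k‖ * C) (hsc.mul_right _)
      (fun k y => (h₂ k y).const_smul (c k)) hsmul (x₀ := 0) ?_ v
    simp [h₀']
  · refine continuous_tsum (f := fun k v => (c k : ℂ) • ψ'' k v)
      (fun k => (hcont k).const_smul (c k)) (hsc.mul_right C) fun k y => ?_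
    exact hsmul k y
  · refine tsum_of_norm_bounded (g := fun k => ‖c k‖ * (C * ‖v‖ ^ 2)) ?_ fun k => ?_
    · have := (l1_hasSum_norm c).mul_right (C * ‖v‖ ^ 2)
      rwa [mul_left_comm, ← mul_assoc] at this
    · rw [norm_smul]
      exact mul_le_mul_of_nonneg_left (hb k v) (norm_nonneg _)

/-- The rank-one complex bilinear form of a real covector. -/
def covectorSq (k : V →L[ℝ] ℝ) : V →L[ℝ] V →L[ℝ] ℂ :=
  k.smulRight (Complex.ofRealCLM.comp k)

theorem covectorSq_apply (k : V →L[ℝ] ℝ) (a b : V) : covectorSq k a b = (k a * k b : ℂ) := by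
  simp [covectorSq]

theorem norm_covectorSq_le (k : V →L[ℝ] ℝ) : ‖covectorSq k‖ ≤ ‖k‖ ^ 2 := by
  refine ContinuousLinearMap.opNorm_le_bound₂ _ (by positivity) fun a b => ?_
  rw [covectorSq_apply, norm_mul, Complex.norm_real, Complex.norm_real]
  calc ‖k a‖ * ‖k b‖ ≤ (‖k‖ * ‖a‖) * (‖k‖ * ‖b‖) := by gcongr <;> exact k.le_opNorm _
    _ = ‖k‖ ^ 2 * ‖a‖ * ‖b‖ := by ring

/-- A function with second derivative `exp (i k v) • k ⊗ k` that vanishes to second order at the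
origin. -/
theorem exists_character_primitive (k : V →L[ℝ] ℝ) :
    ∃ (ψ : V → ℂ) (ψ' : V → V →L[ℝ] ℂ), (∀ v, HasFDerivAt ψ (ψ' v) v) ∧
      (∀ v, HasFDerivAt ψ' (Complex.exp ((k v : ℂ) * Complex.I) • covectorSq k) v) ∧
      ψ 0 = 0 ∧ ψ' 0 = 0 := by
  have hkc : ∀ v, HasFDerivAt (fun v => (k v : ℂ)) (Complex.ofRealCLM.comp k) v := fun v =>
    (Complex.ofRealCLM.comp k).hasFDerivAt
  have hexp : ∀ v, HasFDerivAt (fun v => Complex.exp ((k v : ℂ) * Complex.I))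
      (Complex.exp ((k v : ℂ) * Complex.I) • Complex.I • Complex.ofRealCLM.comp k) v := fun v =>
    ((hkc v).mul_const Complex.I).cexp
  refine ⟨fun v => -(Complex.exp ((k v : ℂ) * Complex.I) - 1 - Complex.I * k v),
    fun v => (-Complex.I * (Complex.exp ((k v : ℂ) * Complex.I) - 1)) • Complex.ofRealCLM.comp k,
    fun v => ?_, fun v => ?_, by simp, ?_⟩
  · refine (((hexp v).sub_const 1).sub ((hkc v).const_mul Complex.I)).neg.congr_fderiv ?_
    ext a
    simp
    ring
  · refine ((((hexp v).sub_const 1).const_mul (-Complex.I)).smul_const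
      (Complex.ofRealCLM.comp k)).congr_fderiv ?_
    ext a b
    simp [covectorSq]
    ring_nf
    simp [Complex.I_sq]
  · ext a
    simp

theorem exists_square_primitive (k : V →L[ℝ] ℝ) :
    ∃ (ψ : V → ℂ) (ψ' : V → V →L[ℝ] ℂ), (∀ v, HasFDerivAt ψ (ψ' v) v) ∧
      (∀ v, HasFDerivAt ψ' (covectorSq k) v) ∧ ψ 0 = 0 ∧ ψ' 0 = 0 := by
  have hkc : ∀ v, HasFDerivAt (fun v => (k v : ℂ)) (Complex.ofRealCLM.comp k) v := fun v =>
    (Complex.ofRealCLM.comp k).hasFDerivAt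
  refine ⟨fun v => 2⁻¹ * ((k v : ℂ) * k v), fun v => covectorSq k v, fun v => ?_,
    fun v => (covectorSq k).hasFDerivAt, by simp, by simp⟩
  refine (((hkc v).mul (hkc v)).const_mul (2⁻¹ : ℂ)).congr_fderiv ?_
  ext a
  simp [covectorSq]
  ring

end SecondOrderSeries

section LocalSolutions

variable {n : ℕ}

theorem hasSum_mixedPart {ι : Type*} {F : ι → Cz n → Cz n → ℂ} {S : Cz n → Cz n → ℂ}
    (h : ∀ a b, HasSum (fun k => F k a b) (S a b)) (i j : Fin n) :
    HasSum (fun k => mixedPart (F k) i j) (mixedPart S i j) := by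
  unfold mixedPart
  exact ((((h _ _).add ((h _ _).mul_left _)).sub ((h _ _).mul_left _)).add (h _ _)).div_const _

/-- A normalised potential for the exponential with frequency `k`, whose second derivative has
contraction with `W` equal to that exponential. -/
theorem exists_potential {W : Matrix (Fin n) (Fin n) ℂ} (hW : W.PosDef) {q : ℝ} (hq : 0 < q)
    (hWq : ∀ k : Cz n →L[ℝ] ℝ, q * ‖k‖ ^ 2 ≤ symbol W k)
    {k₁ : Cz n →L[ℝ] ℝ} (hk₁ : k₁ ≠ 0) (k : Cz n →L[ℝ] ℝ) :
    ∃ (ψ : Cz n → ℂ) (ψ' : Cz n → Cz n →L[ℝ] ℂ) (K : Cz n →L[ℝ] Cz n →L[ℝ] ℂ),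
      (∀ v, HasFDerivAt ψ (ψ' v) v) ∧
      (∀ v, HasFDerivAt ψ' (Complex.exp ((k v : ℂ) * Complex.I) • K) v) ∧
      ψ 0 = 0 ∧ ψ' 0 = 0 ∧ ‖K‖ ≤ q⁻¹ ∧ (∀ a b, K a b = K b a) ∧
      mixedTrace W (fun a b => K a b) = 1 := by
  have hK : ∀ m : Cz n →L[ℝ] ℝ, m ≠ 0 →
      ‖((symbol W m)⁻¹ : ℂ) • covectorSq m‖ ≤ q⁻¹ ∧
      (∀ a b, (((symbol W m)⁻¹ : ℂ) • covectorSq m) a b =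
        (((symbol W m)⁻¹ : ℂ) • covectorSq m) b a) ∧
      mixedTrace W (fun a b => (((symbol W m)⁻¹ : ℂ) • covectorSq m) a b) = 1 := by
    intro m hm
    have hs := symbol_pos hW hm
    have hm0 : 0 < ‖m‖ := norm_pos_iff.2 hm
    refine ⟨(ContinuousLinearMap.opNorm_smul_le _ _).trans ?_, fun a b => ?_, ?_⟩
    · rw [norm_inv, Complex.norm_real, Real.norm_of_nonneg hs.le, inv_mul_le_iff₀ hs,
        mul_comm, ← div_eq_inv_mul, le_div_iff₀ hq]
      nlinarith [norm_covectorSq_le m, hWq m]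
    · simp [covectorSq_apply, mul_comm]
    · have : (fun a b => (((symbol W m)⁻¹ : ℂ) • covectorSq m) a b) =
          fun a b => ((symbol W m)⁻¹ : ℂ) * (m a * m b : ℂ) := by
        funext a b
        simp [covectorSq_apply]
      rw [this, mixedTrace_mul, mixedTrace_covector hW.isHermitian]
      exact inv_mul_cancel₀ (by exact_mod_cast hs.ne')
  rcases eq_or_ne k 0 with rfl | hk
  · obtain ⟨ψ, ψ', h1, h2, h3, h4⟩ := exists_square_primitive k₁
    refine ⟨fun v => ((symbol W k₁)⁻¹ : ℂ) • ψ v, fun v => ((symbol W k₁)⁻¹ : ℂ) • ψ' v, _,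
      fun v => (h1 v).const_smul ((symbol W k₁)⁻¹ : ℂ), fun v => ?_, by simp [h3], ?_, hK k₁ hk₁⟩
    · refine ((h2 v).const_smul ((symbol W k₁)⁻¹ : ℂ)).congr_fderiv ?_
      ext a b
      simp
    · ext a
      simp [h4]
  · obtain ⟨ψ, ψ', h1, h2, h3, h4⟩ := exists_character_primitive k
    refine ⟨fun v => ((symbol W k)⁻¹ : ℂ) • ψ v, fun v => ((symbol W k)⁻¹ : ℂ) • ψ' v, _,
      fun v => (h1 v).const_smul ((symbol W k)⁻¹ : ℂ), fun v => ?_, by simp [h3], ?_, hK k hk⟩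
    · refine ((h2 v).const_smul ((symbol W k)⁻¹ : ℂ)).congr_fderiv ?_
      ext a b
      simp
      ring
    · ext a
      simp [h4]

theorem continuous_character_smul {V : Type*} [NormedAddCommGroup V] [NormedSpace ℝ V]
    (k : V →L[ℝ] ℝ) (K : V →L[ℝ] V →L[ℝ] ℂ) :
    Continuous fun v => Complex.exp ((k v : ℂ) * Complex.I) • K := by
  have h : Continuous fun v => Complex.exp ((k v : ℂ) * Complex.I) := by fun_prop
  have hL : LipschitzWith ‖K‖₊ fun z : ℂ => z • K := LipschitzWith.of_dist_le_mul fun z z' => by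
    have hzz : z • K - z' • K = (z - z') • K := by
      ext a b
      simp [sub_mul]
    rw [dist_eq_norm, dist_eq_norm, hzz, mul_comm]
    exact ContinuousLinearMap.opNorm_smul_le (z - z') K
  exact hL.continuous.comp h

theorem hasSum_clm_apply {ι V F : Type*} [NormedAddCommGroup V] [NormedSpace ℝ V]
    [NormedAddCommGroup F] [NormedSpace ℝ F] [CompleteSpace F] {H : ι → V →L[ℝ] F} {g : ι → ℝ}
    (hg : Summable g) (hH : ∀ k, ‖H k‖ ≤ g k) (a : V) :
    HasSum (fun k => H k a) ((∑' k, H k) a) :=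
  (ContinuousLinearMap.apply ℝ F a).hasSum (Summable.of_norm_bounded hg hH).hasSum

theorem hasSum_clm_apply_apply {ι V : Type*} [NormedAddCommGroup V] [NormedSpace ℝ V]
    {H : ι → V →L[ℝ] V →L[ℝ] ℂ} {g : ι → ℝ}
    (hg : Summable g) (hH : ∀ k, ‖H k‖ ≤ g k) (a b : V) :
    HasSum (fun k => H k a b) ((∑' k, H k) a b) := by
  have ha := hasSum_clm_apply hg hH a
  exact (ContinuousLinearMap.apply ℝ ℂ b).hasSum ha

theorem norm_coeff_smul_le {ι V : Type*} [NormedAddCommGroup V] [NormedSpace ℝ V]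
    (c : L1 ι) {F : ι → V →L[ℝ] V →L[ℝ] ℂ} {C : ℝ} (hF : ∀ k, ‖F k‖ ≤ C) (k : ι) :
    ‖c k • F k‖ ≤ ‖c k‖ * C :=
  (ContinuousLinearMap.opNorm_smul_le (c k) (F k)).trans
    (mul_le_mul_of_nonneg_left (hF k) (norm_nonneg _))

theorem hasSum_coeff_smul_apply {ι V : Type*} [NormedAddCommGroup V] [NormedSpace ℝ V]
    (c : L1 ι) {F : ι → V →L[ℝ] V →L[ℝ] ℂ} {C : ℝ} (hF : ∀ k, ‖F k‖ ≤ C) (a b : V) :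
    HasSum (fun k => (c k • F k) a b) ((∑' k, c k • F k) a b) :=
  hasSum_clm_apply_apply ((l1_hasSum_norm c).summable.mul_right C) (norm_coeff_smul_le c hF) a b

theorem hasSum_mul_bilinear_apply {ι V : Type*} [NormedAddCommGroup V] [NormedSpace ℝ V]
    (c : L1 ι) {F : ι → V →L[ℝ] V →L[ℝ] ℂ} {C : ℝ} (hF : ∀ k, ‖F k‖ ≤ C) (a b : V) :
    HasSum (fun k => c k * F k a b) ((∑' k, c k • F k) a b) :=
  hasSum_coeff_smul_apply c hF a b

theorem exists_add_apply_eq {X : Type*} [NormedAddCommGroup X] [NormedSpace ℂ X] [CompleteSpace X]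
    {T : X →L[ℂ] X} (hT : ‖T‖ ≤ 1 / 2) (f : X) : ∃ c, c + T c = f ∧ ‖c‖ ≤ 2 * ‖f‖ := by
  let e := Units.oneSub (-T) (by rw [norm_neg]; linarith)
  have he : (e : X →L[ℂ] X) = 1 + T := by simp [e]
  refine ⟨(↑e⁻¹ : X →L[ℂ] X) f, ?_, ?_⟩
  · have := DFunLike.congr_fun e.mul_inv f
    rw [he] at this
    simpa using this
  · set c := (↑e⁻¹ : X →L[ℂ] X) f with hc
    have h1 : c + T c = f := by
      have := DFunLike.congr_fun e.mul_inv f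
      rw [he] at this
      simpa using this
    have h2 : ‖c‖ ≤ ‖f‖ + ‖T c‖ := by
      rw [← h1]
      simpa using norm_sub_le (c + T c) (T c)
    have h3 : ‖T c‖ ≤ 1 / 2 * ‖c‖ := (T.le_opNorm c).trans (by gcongr)
    linarith

/-- Bounded operators on absolutely summable Fourier coefficients that represent the mixed second
derivatives of a bounded solution operator for a positive definite matrix. -/
theorem exists_solution_operator {W : Matrix (Fin n) (Fin n) ℂ} (hW : W.PosDef)
    {k₁ : Cz n →L[ℝ] ℝ} (hk₁ : k₁ ≠ 0) :
    ∃ (C : ℝ) (M : Fin n → Fin n → L1 (Cz n →L[ℝ] ℝ) →L[ℂ] L1 (Cz n →L[ℝ] ℝ)), 0 < C ∧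
      (∀ i j, ‖M i j‖ ≤ C) ∧ (∀ c, ∑ i, ∑ j, W i j • M i j c = c) ∧
      ∀ c, ∃ (w : Cz n → ℂ) (G : Cz n → Cz n →L[ℝ] ℂ) (D : Cz n → Cz n →L[ℝ] Cz n →L[ℝ] ℂ),
        (∀ v, HasFDerivAt w (G v) v) ∧ (∀ v, HasFDerivAt G (D v) v) ∧ Continuous D ∧
        (∀ v a b, D v a b = D v b a) ∧
        (∀ v i j, mixedPart (fun a b => D v a b) i j = l1Eval v (M i j c)) ∧
        ∀ v, ‖w v‖ ≤ C * ‖c‖ * ‖v‖ ^ 2 := by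
  obtain ⟨q, hq, q₁, hq₁, hWq⟩ := exists_symbol_bounds (W := fun _ => W)
    (isCompact_singleton (x := (0 : Cz n))) (fun i j => continuousOn_singleton _ _) (fun _ _ => hW)
  choose ψ ψ' K hψ hψ' hψ0 hψ'0 hKn hKsymm hKtr using
    exists_potential hW hq (fun k => (hWq 0 rfl k).1) hk₁
  have hC0 : 0 < q⁻¹ := inv_pos.2 hq
  have hKC : ∀ k a b, ‖K k a b‖ ≤ q⁻¹ * ‖a‖ * ‖b‖ := fun k a b =>
    ((K k).le_opNorm₂ a b).trans (by gcongr; exact hKn k)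
  let μ : Fin n → Fin n → (Cz n →L[ℝ] ℝ) → ℂ := fun i j k => mixedPart (fun a b => K k a b) i j
  have hμC : ∀ i j k, ‖μ i j k • l1Delta k‖ ≤ q⁻¹ := fun i j k => by
    rw [norm_smul, norm_l1Delta, mul_one]
    exact norm_mixedPart_le (hKC k) i j
  have hMsum : ∑ i, ∑ j, W i j • l1Lift (fun k => μ i j k • l1Delta k) q⁻¹ (hμC i j) = 1 := by
    refine l1_ext fun k => ?_
    simp only [sum_apply, FunLike.coe_smul, Pi.smul_apply, l1Lift_delta,
      smul_smul, ← Finset.sum_smul]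
    have : ∑ i, ∑ j, W i j * μ i j k = 1 := hKtr k
    rw [this, one_smul, one_apply_eq_self]
  refine ⟨q⁻¹, fun i j => l1Lift (fun k => μ i j k • l1Delta k) q⁻¹ (hμC i j), hC0,
    fun i j => norm_l1Lift_le _ hC0.le, fun c => ?_, fun c => ?_⟩
  · have := DFunLike.congr_fun hMsum c
    simpa only [sum_apply, FunLike.coe_smul, Pi.smul_apply,
      one_apply_eq_self] using this
  have hKe : ∀ k v, ‖Complex.exp ((k v : ℂ) * Complex.I) • K k‖ ≤ q⁻¹ := fun k v =>
    (ContinuousLinearMap.opNorm_smul_le _ _).trans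
      ((mul_le_of_le_one_left (norm_nonneg _) (norm_character k v)).trans (hKn k))
  obtain ⟨G, hG, hH, hHc, hwn⟩ := tsum_second_order
    (ψ'' := fun k v => Complex.exp ((k v : ℂ) * Complex.I) • K k) hψ hψ' hψ0 hψ'0
    hKe (fun k => continuous_character_smul k (K k)) c
  set D : Cz n → Cz n →L[ℝ] Cz n →L[ℝ] ℂ :=
    fun v => ∑' k, c k • Complex.exp ((k v : ℂ) * Complex.I) • K k with hD
  have hDab : ∀ v a b, HasSum
      (fun k => (c k * Complex.exp ((k v : ℂ) * Complex.I)) * K k a b) (D v a b) := by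
    intro v a b
    refine (hasSum_mul_bilinear_apply c (fun k => hKe k v) a b).congr_fun fun k => ?_
    exact mul_assoc _ _ _
  refine ⟨_, G, D, hG, hH, hHc, fun v a b => ?_, fun v i j => ?_, hwn⟩
  · exact (hDab v a b).unique ((hDab v b a).congr_fun fun k => by rw [hKsymm k a b])
  · refine (hasSum_mixedPart (hDab v) i j).unique ?_
    refine (l1Lift_comp (hμC i j) (l1Eval v) c).congr_fun fun k => ?_
    rw [mixedPart_mul, map_smul, l1Eval_delta, smul_eq_mul, smul_eq_mul]
    ring

/-- A quadratic polynomial plus the real part of a complex function: regularity and mixed second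
derivatives. -/
theorem quadratic_add_re {w : Cz n → ℂ} {G : Cz n → Cz n →L[ℝ] ℂ}
    {D : Cz n → Cz n →L[ℝ] Cz n →L[ℝ] ℂ} (hG : ∀ v, HasFDerivAt w (G v) v)
    (hD : ∀ v, HasFDerivAt G (D v) v) (hDc : Continuous D) (x : Cz n) (τ : ℝ)
    (l : Cz n →L[ℝ] ℝ) (P : Cz n →L[ℝ] Cz n →L[ℝ] ℝ) (hP : ∀ a b, P a b = P b a) :
    ContDiff ℝ 2 (fun y => τ + l (y - x) + P (y - x) (y - x) / 2 + (w (y - x)).re) ∧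
      ∀ z i j, cHess (fun y => τ + l (y - x) + P (y - x) (y - x) / 2 + (w (y - x)).re) i j z =
        mixedPart (fun a b => (((P a b : ℂ) + D (z - x) a b).re : ℂ)) i j := by
  let R : (Cz n →L[ℝ] ℂ) →L[ℝ] (Cz n →L[ℝ] ℝ) :=
    ContinuousLinearMap.compL ℝ (Cz n) ℂ ℝ Complex.reCLM
  have hs : ∀ y, HasFDerivAt (fun y => y - x) (ContinuousLinearMap.id ℝ (Cz n)) y := fun y =>
    (hasFDerivAt_id y).sub_const x
  have h1 : ∀ y, HasFDerivAt
      (fun y => τ + l (y - x) + P (y - x) (y - x) / 2 + (w (y - x)).re)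
      (l + P (y - x) + R (G (y - x))) y := by
    intro y
    have hl : HasFDerivAt (fun y => l (y - x)) l y :=
      (l.hasFDerivAt.comp y (hs y)).congr_fderiv (by ext; simp)
    have hq : HasFDerivAt (fun y => P (y - x) (y - x) / 2) (P (y - x)) y := by
      have := ((P.hasFDerivAt.comp y (hs y)).clm_apply (hs y)).mul_const (2⁻¹ : ℝ)
      refine this.congr_fderiv ?_
      ext a
      simp
      rw [hP a y, hP a x]
      ring
    have hr : HasFDerivAt (fun y => (w (y - x)).re) (R (G (y - x))) y :=
      (Complex.reCLM.hasFDerivAt.comp y ((hG (y - x)).comp y (hs y))).congr_fderiv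
        (by ext; simp [R])
    exact ((hl.const_add τ).add hq).add hr
  have h2 : ∀ y, HasFDerivAt (fun y => l + P (y - x) + R (G (y - x)))
      (P + R.comp (D (y - x))) y := by
    intro y
    have hp : HasFDerivAt (fun y => P (y - x)) P y :=
      (P.hasFDerivAt.comp y (hs y)).congr_fderiv (by ext; simp)
    have hr : HasFDerivAt (fun y => R (G (y - x))) (R.comp (D (y - x))) y :=
      (R.hasFDerivAt.comp y ((hD (y - x)).comp y (hs y))).congr_fderiv (by ext; simp)
    exact (hp.const_add l).add hr
  refine ⟨contDiff_two_of_hasFDerivAt h1 h2 ?_, fun z i j => ?_⟩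
  · have : Continuous fun y => D (y - x) := hDc.comp (continuous_id.sub continuous_const)
    exact continuous_const.add (continuous_const.clm_comp this)
  · rw [cHess_eq_mixedPart (Eventually.of_forall h1) (h2 z)]
    simp [R]

/-- Every quadratic polynomial annihilated by the operator frozen at `x` is approximated near `x`,
to second order, by solutions of the equation with variable coefficients. -/
theorem eventually_exists_solution {Ω : Set (Cz n)} (hΩ : IsOpen Ω)
    {W : Cz n → Matrix (Fin n) (Fin n) ℂ}
    (hW : ∀ i j, ContDiffOn ℝ ((⊤ : ℕ∞) : WithTop ℕ∞) (fun z => W z i j) Ω)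
    (hpos : ∀ z ∈ Ω, (W z).PosDef) {x : Cz n} (hx : x ∈ Ω) {k₁ : Cz n →L[ℝ] ℝ} (hk₁ : k₁ ≠ 0)
    (l : Cz n →L[ℝ] ℝ) (P : Cz n →L[ℝ] Cz n →L[ℝ] ℝ) (hPsymm : ∀ a b, P a b = P b a)
    (hP : mixedTrace (W x) (fun a b => (P a b : ℂ)) = 0) {ε : ℝ} (hε : 0 < ε) :
    ∀ᶠ ρ in 𝓝[>] (0 : ℝ), ∀ τ : ℝ, ∃ h : Cz n → ℝ, ContDiff ℝ 2 h ∧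
      (∀ z ∈ Metric.ball x ρ, ∑ i, ∑ j, W z i j * cHess h i j z = 0) ∧
      ∀ v, |h (x + v) - (τ + l v + P v v / 2)| ≤ ε * ‖v‖ ^ 2 := by
  obtain ⟨C, M, hC0, hMn, hMsum, hsol⟩ := exists_solution_operator (hpos x hx) hk₁
  set p : Fin n → Fin n → ℂ := fun i j => mixedPart (fun a b => (P a b : ℂ)) i j with hp
  set N : ℝ := ∑ _i : Fin n, ∑ _j : Fin n, C with hN
  set S : ℝ := ∑ i, ∑ j, ‖p i j‖ with hS
  have hN0 : 0 ≤ N := Finset.sum_nonneg fun _ _ => Finset.sum_nonneg fun _ _ => hC0.le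
  have hS0 : 0 ≤ S := Finset.sum_nonneg fun _ _ => Finset.sum_nonneg fun _ _ => norm_nonneg _
  set δ : ℝ := min 1 ε / (2 * (N + C * (2 * S) + 1)) with hδ
  have hden : 0 < 2 * (N + C * (2 * S) + 1) := by positivity
  have hmin : 0 < min 1 ε := lt_min one_pos hε
  have hδ0 : 0 < δ := div_pos hmin hden
  have hδmul : δ * (2 * (N + C * (2 * S) + 1)) = min 1 ε := div_mul_cancel₀ _ hden.ne'
  have hδN : δ * N ≤ 1 / 2 := by
    have : 0 ≤ δ * (C * (2 * S)) := by positivity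
    linarith [min_le_left 1 ε]
  have hδS : C * (2 * (δ * S)) ≤ ε := by
    have : 0 ≤ δ * N := by positivity
    have : 0 ≤ δ * (C * (2 * S)) := by positivity
    nlinarith [min_le_right 1 ε]
  have hball : ∀ᶠ ρ in 𝓝[>] (0 : ℝ), Metric.ball x ρ ⊆ Ω := by
    obtain ⟨r, hr, hrΩ⟩ := Metric.isOpen_iff.1 hΩ x hx
    filter_upwards [mem_nhdsWithin_of_mem_nhds (gt_mem_nhds hr)] with ρ hρ
    exact (Metric.ball_subset_ball (le_of_lt hρ)).trans hrΩ
  have hrep : ∀ᶠ ρ in 𝓝[>] (0 : ℝ), ∀ i j, ∃ B,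
      Represents ρ (fun v => W (x + v) i j - W x i j) B ∧ ‖B‖ ≤ δ := by
    rw [eventually_all]
    intro i
    rw [eventually_all]
    intro j
    exact eventually_exists_represents hΩ ((hW i j).sub contDiffOn_const) hx (sub_self _) hδ0
  filter_upwards [hball, hrep] with ρ hρΩ hB
  choose B hBrep hBn using hB
  set T : L1 (Cz n →L[ℝ] ℝ) →L[ℂ] L1 (Cz n →L[ℝ] ℝ) := ∑ i, ∑ j, (B i j).comp (M i j) with hT
  have hTn : ‖T‖ ≤ 1 / 2 := by
    refine le_trans ?_ hδN
    rw [hN, Finset.mul_sum]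
    refine (norm_sum_le _ _).trans (Finset.sum_le_sum fun i _ => ?_)
    rw [Finset.mul_sum]
    refine (norm_sum_le _ _).trans (Finset.sum_le_sum fun j _ => ?_)
    exact ((B i j).opNorm_comp_le (M i j)).trans
      (mul_le_mul (hBn i j) (hMn i j) (norm_nonneg _) hδ0.le)
  set f : L1 (Cz n →L[ℝ] ℝ) := -∑ i, ∑ j, p i j • B i j (l1Delta 0) with hf
  have hfn : ‖f‖ ≤ δ * S := by
    rw [hf, norm_neg, hS, Finset.mul_sum]
    refine (norm_sum_le _ _).trans (Finset.sum_le_sum fun i _ => ?_)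
    rw [Finset.mul_sum]
    refine (norm_sum_le _ _).trans (Finset.sum_le_sum fun j _ => ?_)
    rw [norm_smul, mul_comm]
    refine mul_le_mul_of_nonneg_right (((B i j).le_opNorm _).trans ?_) (norm_nonneg _)
    rw [norm_l1Delta, mul_one]
    exact hBn i j
  obtain ⟨c, hc, hcn⟩ := exists_add_apply_eq hTn f
  obtain ⟨w, G, D, hG, hD, hDc, hDsymm, hDM, hwn⟩ := hsol c
  have hDtr : ∀ v, ‖v‖ < ρ →
      mixedTrace (W (x + v)) (fun a b => (P a b : ℂ) + D v a b) = 0 := by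
    intro v hv
    have h1 : mixedTrace (W (x + v)) (fun a b => (P a b : ℂ)) =
        l1Eval v (∑ i, ∑ j, p i j • B i j (l1Delta 0)) := by
      rw [← sub_zero (mixedTrace (W (x + v)) _), ← hP]
      simp only [mixedTrace, map_sum, map_smul, ← Finset.sum_sub_distrib]
      refine Finset.sum_congr rfl fun i _ => Finset.sum_congr rfl fun j _ => ?_
      rw [hBrep i j v hv, l1Eval_delta]
      simp [hp]
      ring
    have h2 : mixedTrace (W (x + v)) (fun a b => D v a b) = l1Eval v (c + T c) := by
      have h3 : l1Eval v c = ∑ i, ∑ j, W x i j * l1Eval v (M i j c) := by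
        conv_lhs => rw [← hMsum c]
        simp only [map_sum, map_smul, smul_eq_mul]
      have h4 : l1Eval v (T c) =
          ∑ i, ∑ j, (W (x + v) i j - W x i j) * l1Eval v (M i j c) := by
        simp only [hT, sum_apply, ContinuousLinearMap.comp_apply, map_sum,
          hBrep _ _ v hv]
      rw [map_add, h3, h4]
      simp only [mixedTrace, hDM, ← Finset.sum_add_distrib]
      exact Finset.sum_congr rfl fun i _ => Finset.sum_congr rfl fun j _ => by ring
    rw [mixedTrace_add, h1, h2, hc, hf, map_neg, add_neg_cancel]
  intro τ
  obtain ⟨hcd, hcH⟩ := quadratic_add_re hG hD hDc x τ l P hPsymm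
  refine ⟨_, hcd, fun z hz => ?_, fun v => ?_⟩
  · have hv : ‖z - x‖ < ρ := by simpa [dist_eq_norm] using hz
    have h1 := hDtr (z - x) hv
    rw [add_sub_cancel] at h1
    have h2 := mixedTrace_re (W := W z) (hpos z (hρΩ hz)).isHermitian
      (F := fun a b => (P a b : ℂ) + D (z - x) a b)
      (fun a b => by rw [hPsymm a b, hDsymm (z - x) a b])
    rw [h1, Complex.zero_re, Complex.ofReal_zero] at h2
    simp only [hcH]
    exact h2
  · rw [add_sub_cancel_left, add_sub_cancel_left]
    refine (Complex.abs_re_le_norm _).trans ((hwn v).trans ?_)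
    refine mul_le_mul_of_nonneg_right (le_trans ?_ hδS) (by positivity)
    exact mul_le_mul_of_nonneg_left (by linarith) hC0.le

end LocalSolutions

section Touching

variable {n : ℕ}

theorem contDiffOn_det {m : WithTop ℕ∞} {A : Cz n → Matrix (Fin n) (Fin n) ℂ} {S : Set (Cz n)}
    (hA : ∀ i j, ContDiffOn ℝ m (fun z => A z i j) S) : ContDiffOn ℝ m (fun z => (A z).det) S := by
  simp only [Matrix.det_apply]
  refine ContDiffOn.sum fun σ _ => ?_
  exact (contDiffOn_prod fun i _ => hA _ _).const_smul _

theorem contDiffOn_inv_apply {m : WithTop ℕ∞} {A : Cz n → Matrix (Fin n) (Fin n) ℂ}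
    {S : Set (Cz n)} (hA : ∀ i j, ContDiffOn ℝ m (fun z => A z i j) S)
    (hdet : ∀ z ∈ S, (A z).det ≠ 0) (i j : Fin n) :
    ContDiffOn ℝ m (fun z => (A z)⁻¹ i j) S := by
  simp only [Matrix.inv_def, Ring.inverse_eq_inv', Matrix.smul_apply, smul_eq_mul,
    Matrix.adjugate_apply]
  refine ((contDiffOn_det hA).inv hdet).mul (contDiffOn_det fun k l => ?_)
  by_cases h : k = j
  · simpa [Matrix.updateRow_apply, h] using contDiffOn_const
  · simpa [Matrix.updateRow_apply, h] using hA k l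

/-- The real bilinear form that is the sum of the squares of a finite family of covectors. -/
def sumSq {ι : Type*} [Fintype ι] (k : ι → Cz n →L[ℝ] ℝ) : Cz n →L[ℝ] Cz n →L[ℝ] ℝ :=
  ∑ m, (k m).smulRight (k m)

theorem sumSq_apply {ι : Type*} [Fintype ι] (k : ι → Cz n →L[ℝ] ℝ) (a b : Cz n) :
    sumSq k a b = ∑ m, k m a * k m b := by
  simp [sumSq]

theorem mixedTrace_sumSq {ι : Type*} [Fintype ι] {W : Matrix (Fin n) (Fin n) ℂ}
    (hW : W.IsHermitian) (k : ι → Cz n →L[ℝ] ℝ) :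
    mixedTrace W (fun a b => (sumSq k a b : ℂ)) = ((∑ m, symbol W (k m) : ℝ) : ℂ) := by
  simp only [sumSq_apply, Complex.ofReal_sum, Complex.ofReal_mul, mixedTrace_sum,
    mixedTrace_covector hW]

/-- The coordinate covectors of a Euclidean chart. -/
def chartCovector {d : ℕ} (T : Cz n ≃L[ℝ] EuclideanSpace ℝ (Fin d)) (m : Fin d) : Cz n →L[ℝ] ℝ :=
  (EuclideanSpace.proj m : EuclideanSpace ℝ (Fin d) →L[ℝ] ℝ).comp
    (T : Cz n →L[ℝ] EuclideanSpace ℝ (Fin d))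

theorem chartCovector_ne_zero {d : ℕ} (T : Cz n ≃L[ℝ] EuclideanSpace ℝ (Fin d)) (m : Fin d) :
    chartCovector T m ≠ 0 := by
  intro h
  have := DFunLike.congr_fun h (T.symm (EuclideanSpace.single m 1))
  simp [chartCovector] at this

theorem sumSq_chartCovector_self {d : ℕ} (T : Cz n ≃L[ℝ] EuclideanSpace ℝ (Fin d)) (v : Cz n) :
    sumSq (chartCovector T) v v = ‖T v‖ ^ 2 := by
  rw [sumSq_apply, EuclideanSpace.real_norm_sq_eq]
  simp [chartCovector, pow_two]

/-- An `ω`-subharmonic function cannot be touched from above by a strictly superharmonic quadratic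
polynomial. -/
theorem OmegaSH.not_eventually_le {Ω : Set (Cz n)} (hΩ : IsOpen Ω)
    {ω : Cz n → Matrix (Fin n) (Fin n) ℂ} (hω : IsHermitianMetricOn ω Ω) {u : Cz n → EReal}
    (hu : OmegaSH ω Ω u) {x : Cz n} (hx : x ∈ Ω) {τ : ℝ} (hτ : u x = τ) (l : Cz n →L[ℝ] ℝ)
    (P : Cz n →L[ℝ] Cz n →L[ℝ] ℝ) (hPsymm : ∀ a b, P a b = P b a)
    (hP : (mixedTrace (ω x)⁻¹ (fun a b => (P a b : ℂ))).re < 0) :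
    ¬ ∀ᶠ y in 𝓝 x, u y ≤ ((τ + l (y - x) + P (y - x) (y - x) / 2 : ℝ) : EReal) := by
  intro htouch
  have hpos : ∀ z ∈ Ω, ((ω z)⁻¹).PosDef := fun z hz => (hω.2 z hz).inv
  have hsm := contDiffOn_inv_apply hω.1 fun z hz => (hω.2 z hz).det_pos.ne'
  obtain ⟨i₀⟩ : Nonempty (Fin n) := by
    by_contra h
    rw [not_nonempty_iff] at h
    simp [mixedTrace] at hP
  let T := toEuclidean (E := Cz n)
  obtain ⟨m₀⟩ : Nonempty (Fin (Module.finrank ℝ (Cz n))) := by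
    by_contra h
    rw [not_nonempty_iff] at h
    have h1 : T (Pi.single i₀ 1) = T 0 := Subsingleton.elim _ _
    have h2 := congrFun (T.injective h1) i₀
    simp at h2
  set Q := sumSq (chartCovector T) with hQ
  set q : ℝ := ∑ m, symbol (ω x)⁻¹ (chartCovector T m) with hq
  have hq0 : 0 < q := Finset.sum_pos
    (fun m _ => symbol_pos (hpos x hx) (chartCovector_ne_zero T m)) ⟨m₀, Finset.mem_univ _⟩
  set t : ℝ := (mixedTrace (ω x)⁻¹ (fun a b => (P a b : ℂ))).re with ht
  have htr : mixedTrace (ω x)⁻¹ (fun a b => (P a b : ℂ)) = t := by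
    have := mixedTrace_re (hpos x hx).isHermitian (F := fun a b => (P a b : ℂ))
      (fun a b => by rw [hPsymm a b])
    simpa only [Complex.ofReal_re] using this
  set s : ℝ := -t / q with hs
  have hs0 : 0 < s := div_pos (by linarith) hq0
  have hPQ : mixedTrace (ω x)⁻¹ (fun a b => ((P + s • Q) a b : ℂ)) = 0 := by
    have h1 : (fun a b => ((P + s • Q) a b : ℂ)) =
        fun a b => (P a b : ℂ) + (s : ℂ) * (Q a b : ℂ) := by
      funext a b
      simp
    rw [h1, mixedTrace_add, mixedTrace_mul, htr, hQ, mixedTrace_sumSq (hpos x hx).isHermitian,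
      ← hq, ← Complex.ofReal_mul, ← Complex.ofReal_add, hs, div_mul_cancel₀ _ hq0.ne',
      add_neg_cancel, Complex.ofReal_zero]
  have hPQsymm : ∀ a b, (P + s • Q) a b = (P + s • Q) b a := fun a b => by
    simp [hPsymm a b, hQ, sumSq_apply, mul_comm]
  set L : ℝ := ‖(T.symm : EuclideanSpace ℝ (Fin (Module.finrank ℝ (Cz n))) →L[ℝ] Cz n)‖ + 1 with hL
  have hL0 : 0 < L := by positivity
  have hLv : ∀ v, ‖v‖ ≤ L * ‖T v‖ := fun v => by
    have h1 := (T.symm : EuclideanSpace ℝ (Fin (Module.finrank ℝ (Cz n))) →L[ℝ] Cz n).le_opNorm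
      (T v)
    simp only [ContinuousLinearEquiv.coe_coe, ContinuousLinearEquiv.symm_apply_apply] at h1
    nlinarith [norm_nonneg (T v)]
  set ε : ℝ := s / (4 * L ^ 2) with hε
  have hε0 : 0 < ε := by positivity
  have hεs : ε * (4 * L ^ 2) = s := div_mul_cancel₀ _ (by positivity)
  have hsol := eventually_exists_solution hΩ hsm hpos hx (chartCovector_ne_zero T m₀) l
    (P + s • Q) hPQsymm hPQ hε0
  obtain ⟨r, hr, hrΩ⟩ := Metric.eventually_nhds_iff_ball.1 (htouch.and (hΩ.mem_nhds hx))
  have hlt : ∀ᶠ ρ in 𝓝[>] (0 : ℝ), ρ < r := mem_nhdsWithin_of_mem_nhds (gt_mem_nhds hr)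
  obtain ⟨ρ, ⟨hρ, hρr⟩, hρ0⟩ := ((hsol.and hlt).and self_mem_nhdsWithin).exists
  have hρ0 : 0 < ρ := hρ0
  obtain ⟨h, hcd, hlap, hbd⟩ := hρ (τ - ε * ρ ^ 2)
  have hcl : closure (Metric.ball x ρ) = Metric.closedBall x ρ := closure_ball x hρ0.ne'
  have hsub : Metric.closedBall x ρ ⊆ Metric.ball x r := Metric.closedBall_subset_ball hρr
  have key := hu.maxPrinciple (Metric.ball x ρ) Metric.isOpen_ball
    (hcl ▸ isCompact_closedBall x ρ) (hcl ▸ fun z hz => (hrΩ z (hsub hz)).2) h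
    hcd.continuous.continuousOn hcd.contDiffOn hlap ?_ x (subset_closure (Metric.mem_ball_self hρ0))
  · rw [hτ, EReal.coe_le_coe_iff] at key
    have h0 := hbd 0
    simp only [add_zero, map_zero, norm_zero, abs_le] at h0
    nlinarith [h0.2, mul_pos hε0 (pow_pos hρ0 2)]
  · intro z hz
    have hzρ : ‖z - x‖ = ρ := by
      have := Metric.frontier_ball_subset_sphere hz
      simpa [dist_eq_norm] using this
    have hzr : z ∈ Metric.ball x r := hsub (by simp [dist_eq_norm, hzρ])
    refine (hrΩ z hzr).1.trans (EReal.coe_le_coe_iff.2 ?_)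
    have h1 := (abs_le.1 (hbd (z - x))).1
    have h2 := hLv (z - x)
    have h3 : (P + s • Q) (z - x) (z - x) = P (z - x) (z - x) + s * ‖T (z - x)‖ ^ 2 := by
      rw [← sumSq_chartCovector_self, ← hQ]
      rfl
    rw [add_sub_cancel, h3, hzρ] at h1
    rw [hzρ] at h2
    have h4 : ρ ^ 2 ≤ L ^ 2 * ‖T (z - x)‖ ^ 2 := by
      rw [← mul_pow]
      exact pow_le_pow_left₀ hρ0.le h2 2
    have h5 : 4 * ε * ρ ^ 2 ≤ s * ‖T (z - x)‖ ^ 2 := by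
      rw [← hεs]
      nlinarith
    linarith

end Touching

section Comparison

variable {n : ℕ}

open scoped RealInnerProductSpace

/-- The quadratic form of the paraboloids with one strongly concave direction, in a Euclidean
chart. -/
def paraboloidForm {d : ℕ} (T : Cz n ≃L[ℝ] EuclideanSpace ℝ (Fin d)) (A a : ℝ)
    (k : Cz n →L[ℝ] ℝ) : Cz n →L[ℝ] Cz n →L[ℝ] ℝ :=
  (2 * a) • (sumSq (chartCovector T) - A • k.smulRight k)

theorem paraboloidForm_apply {d : ℕ} (T : Cz n ≃L[ℝ] EuclideanSpace ℝ (Fin d)) (A a : ℝ)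
    (k : Cz n →L[ℝ] ℝ) (v w : Cz n) : paraboloidForm T A a k v w =
      2 * a * (sumSq (chartCovector T) v w - A * (k v * k w)) := by
  simp [paraboloidForm]

/-- A uniform aperture making all paraboloids strictly superharmonic on a compact set. -/
theorem exists_paraboloidForm_neg {d : ℕ} (T : Cz n ≃L[ℝ] EuclideanSpace ℝ (Fin d))
    {W : Cz n → Matrix (Fin n) (Fin n) ℂ} {K : Set (Cz n)} (hK : IsCompact K)
    (hcont : ∀ i j, ContinuousOn (fun z => W z i j) K) (hpos : ∀ z ∈ K, (W z).PosDef) :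
    ∃ A > (1 : ℝ), ∀ z ∈ K, ∀ e : EuclideanSpace ℝ (Fin d), ‖e‖ = 1 → ∀ a > 0,
      (mixedTrace (W z) (fun v w => (paraboloidForm T A a
        ((innerSL ℝ e).comp (T : Cz n →L[ℝ] EuclideanSpace ℝ (Fin d))) v w : ℂ))).re < 0 := by
  obtain ⟨q₀, hq₀, q₁, hq₁, hq⟩ := exists_symbol_bounds hK hcont hpos
  set S : ℝ := ∑ m, q₁ * ‖chartCovector T m‖ ^ 2 with hS
  have hS0 : 0 ≤ S := Finset.sum_nonneg fun m _ => by positivity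
  set L : ℝ := ‖(T.symm : EuclideanSpace ℝ (Fin d) →L[ℝ] Cz n)‖ + 1 with hL
  have hL0 : 0 < L := by positivity
  refine ⟨S * L ^ 2 / q₀ + 2, ?_, fun z hz e he a ha => ?_⟩
  · have : 0 ≤ S * L ^ 2 / q₀ := by positivity
    linarith
  set A : ℝ := S * L ^ 2 / q₀ + 2 with hA
  set k : Cz n →L[ℝ] ℝ := (innerSL ℝ e).comp (T : Cz n →L[ℝ] EuclideanSpace ℝ (Fin d)) with hk
  have hA0 : 0 < A := by positivity
  have hWz := (hpos z hz).isHermitian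
  have htr : mixedTrace (W z) (fun v w => (paraboloidForm T A a k v w : ℂ)) =
      ((2 * a * ((∑ m, symbol (W z) (chartCovector T m)) - A * symbol (W z) k) : ℝ) : ℂ) := by
    have h1 : (fun v w => (paraboloidForm T A a k v w : ℂ)) = fun v w =>
        ((2 * a : ℝ) : ℂ) * ((sumSq (chartCovector T) v w : ℂ) +
          ((-A : ℝ) : ℂ) * (k v * k w : ℂ)) := by
      funext v w
      rw [paraboloidForm_apply]
      push_cast
      ring
    rw [h1, mixedTrace_mul, mixedTrace_add, mixedTrace_mul, mixedTrace_sumSq hWz,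
      mixedTrace_covector hWz]
    push_cast
    ring
  rw [htr, Complex.ofReal_re]
  have h1 : ∑ m, symbol (W z) (chartCovector T m) ≤ S :=
    Finset.sum_le_sum fun m _ => (hq z hz _).2
  have h2 : 1 ≤ L * ‖k‖ := by
    have h3 := k.le_opNorm (T.symm e)
    have h4 := (T.symm : EuclideanSpace ℝ (Fin d) →L[ℝ] Cz n).le_opNorm e
    have h5 : k (T.symm e) = 1 := by simp [hk, he]
    rw [h5, norm_one] at h3
    rw [he, mul_one, ContinuousLinearEquiv.coe_coe] at h4
    nlinarith [norm_nonneg k]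
  have h3 : 1 ≤ L ^ 2 * ‖k‖ ^ 2 := by
    rw [← mul_pow]
    exact one_le_pow₀ h2
  have h4 : S < A * symbol (W z) k := by
    have h5 := (hq z hz k).1
    have h6 : A * (q₀ * ‖k‖ ^ 2) ≤ A * symbol (W z) k := mul_le_mul_of_nonneg_left h5 hA0.le
    have h7 : A * (q₀ * ‖k‖ ^ 2) = S * (L ^ 2 * ‖k‖ ^ 2) + 2 * q₀ * ‖k‖ ^ 2 := by
      rw [hA]
      field_simp
    have h8 : 0 < ‖k‖ := by
      by_contra h
      nlinarith [norm_nonneg k]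
    have h9 : 0 < 2 * q₀ * ‖k‖ ^ 2 := by positivity
    nlinarith
  nlinarith

/-- An `ω`-subharmonic function bounded almost everywhere near a point by a constant is bounded by
that constant at the point. -/
theorem OmegaSH.le_of_ae_le {Ω : Set (Cz n)} (hΩ : IsOpen Ω)
    {ω : Cz n → Matrix (Fin n) (Fin n) ℂ} (hω : IsHermitianMetricOn ω Ω) {u : Cz n → EReal}
    (hu : OmegaSH ω Ω u) {z₀ : Cz n} (hz₀ : z₀ ∈ Ω) {c : ℝ} {N : Set (Cz n)} (hN : N ∈ 𝓝 z₀)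
    (hnull : volume {z | z ∈ N ∧ (c : EReal) < u z} = 0) : u z₀ ≤ c := by
  let T := toEuclidean (E := Cz n)
  have hpos : ∀ z ∈ Ω, ((ω z)⁻¹).PosDef := fun z hz => (hω.2 z hz).inv
  have hsm := contDiffOn_inv_apply hω.1 fun z hz => (hω.2 z hz).det_pos.ne'
  obtain ⟨M, hM⟩ := EReal.lt_iff_exists_real_btwn.1 (lt_top_iff_ne_top.2 (hu.ne_top z₀ hz₀))
  have huM : ∀ᶠ z in 𝓝 z₀, u z < M := by
    have := hu.usc z₀ hz₀ M hM.1
    rwa [hΩ.nhdsWithin_eq hz₀] at this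
  have hTz : Tendsto T.symm (𝓝 (T z₀)) (𝓝 z₀) := by
    simpa using T.symm.continuous.tendsto (T z₀)
  obtain ⟨r, hr, hball⟩ := Metric.nhds_basis_closedBall.eventually_iff.1
    (hTz.eventually ((huM.and hN).and (hΩ.mem_nhds hz₀)))
  have hbM : ∀ y ∈ Metric.closedBall (T z₀) r, u (T.symm y) < M := fun y hy => (hball hy).1.1
  have hbN : ∀ y ∈ Metric.closedBall (T z₀) r, T.symm y ∈ N := fun y hy => (hball hy).1.2
  have hbΩ : ∀ y ∈ Metric.closedBall (T z₀) r, T.symm y ∈ Ω := fun y hy => (hball hy).2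
  have hKΩ : T.symm '' Metric.closedBall (T z₀) r ⊆ Ω := Set.image_subset_iff.2 hbΩ
  obtain ⟨A, hA, hneg⟩ := exists_paraboloidForm_neg T
    ((isCompact_closedBall (T z₀) r).image T.symm.continuous)
    (fun i j => ((hsm i j).continuousOn).mono hKΩ) (fun z hz => hpos z (hKΩ hz))
  set U : EuclideanSpace ℝ (Fin (Module.finrank ℝ (Cz n))) → ℝ :=
    fun y => (max (u (T.symm y)) c).toReal with hU
  have hUcoe : ∀ y ∈ Metric.closedBall (T z₀) r, (U y : EReal) = max (u (T.symm y)) c := by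
    intro y hy
    refine EReal.coe_toReal (max_lt ((hbM y hy).trans (EReal.coe_lt_top M))
      (EReal.coe_lt_top c)).ne ?_
    exact ((EReal.bot_lt_coe c).trans_le (le_max_right _ _)).ne'
  have hmem : T z₀ ∈ Metric.closedBall (T z₀) r := Metric.mem_closedBall_self hr.le
  have hnhds : ∀ x ∈ Metric.ball (T z₀) r, ∀ᶠ y in 𝓝 x, y ∈ Metric.closedBall (T z₀) r :=
    fun x hx => mem_of_superset (Metric.isOpen_ball.mem_nhds hx) Metric.ball_subset_closedBall
  have hcU : ∀ y ∈ Metric.closedBall (T z₀) r, c ≤ U y := fun y hy => by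
    rw [← EReal.coe_le_coe_iff, hUcoe y hy]
    exact le_max_right _ _
  have := T.isAddHaarMeasure_map (volume : Measure (Cz n))
  have hle : U (T z₀) ≤ c := by
    refine le_of_ae_le_of_not_touching (Measure.map T volume) (M := max M c) hr hA.le ?_ ?_ ?_ ?_
    · intro x hx t ht
      have hxt : max (u (T.symm x)) c < (t : EReal) := by
        rw [← hUcoe x hx]
        exact EReal.coe_lt_coe_iff.2 ht
      have hux : ∀ᶠ z in 𝓝 (T.symm x), u z < t := by
        have := hu.usc _ (hbΩ x hx) t ((le_max_left _ _).trans_lt hxt)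
        rwa [hΩ.nhdsWithin_eq (hbΩ x hx)] at this
      filter_upwards [mem_nhdsWithin_of_mem_nhds (T.symm.continuous.continuousAt.eventually hux),
        self_mem_nhdsWithin] with y hy hyr
      rw [← EReal.coe_lt_coe_iff, hUcoe y hyr]
      exact max_lt hy ((le_max_right _ _).trans_lt hxt)
    · intro y hy
      rw [← EReal.coe_le_coe_iff, hUcoe y hy]
      exact max_le ((hbM y hy).le.trans (EReal.coe_le_coe_iff.2 (le_max_left _ _)))
        (EReal.coe_le_coe_iff.2 (le_max_right _ _))
    · have hmap := T.toHomeomorph.toMeasurableEquiv.map_apply (μ := volume)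
        {y | y ∈ Metric.closedBall (T z₀) r ∧ c < U y}
      refine hmap.trans (measure_mono_null ?_ hnull)
      rintro z ⟨hz, hcz⟩
      have hz' : T z ∈ Metric.closedBall (T z₀) r := hz
      have hTz' : T.symm (T z) = z := T.symm_apply_apply z
      have h1 : (c : EReal) < U (T z) := EReal.coe_lt_coe_iff.2 hcz
      rw [hUcoe _ hz', hTz'] at h1
      exact ⟨hTz' ▸ hbN _ hz', by simpa using h1⟩
    · intro x hx e he a ha p htouch
      have hxr := Metric.ball_subset_closedBall hx
      rcases le_or_gt (u (T.symm x)) c with hxc | hxc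
      · have hUx : U x = c := by
          rw [← EReal.coe_eq_coe_iff, hUcoe x hxr, max_eq_right hxc]
        have hev : ∀ᶠ y in 𝓝 x, 0 ≤ ⟪p, y - x⟫ + a * ‖y - x‖ ^ 2 - A * a * ⟪e, y - x⟫ ^ 2 := by
          filter_upwards [htouch, hnhds x hx] with y hy hyr
          have := hcU y hyr
          linarith
        have hplus : Tendsto (fun s : ℝ => x + s • e) (𝓝 0) (𝓝 x) := by
          have : Continuous fun s : ℝ => x + s • e := by fun_prop
          simpa using this.tendsto 0
        have hminus : Tendsto (fun s : ℝ => x + (-s) • e) (𝓝 0) (𝓝 x) := by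
          have : Continuous fun s : ℝ => x + (-s) • e := by fun_prop
          simpa using this.tendsto 0
        have hboth := (hplus.eventually hev).and (hminus.eventually hev)
        obtain ⟨s, ⟨h1, h2⟩, hs⟩ := ((hboth.filter_mono nhdsWithin_le_nhds).and
          (self_mem_nhdsWithin (s := Set.Ioi (0 : ℝ)))).exists
        have hs0 : 0 < s := hs
        simp only [add_sub_cancel_left, inner_smul_right, norm_smul, he,
          real_inner_self_eq_norm_sq, norm_neg, Real.norm_eq_abs, mul_one, sq_abs,
          one_pow, neg_mul, neg_sq] at h1 h2
        nlinarith [mul_pos ha (pow_pos hs0 2)]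
      · have hxτ : u (T.symm x) = U x := by rw [hUcoe x hxr, max_eq_left hxc.le]
        set k : Cz n →L[ℝ] ℝ := (innerSL ℝ e).comp
          (T : Cz n →L[ℝ] EuclideanSpace ℝ (Fin (Module.finrank ℝ (Cz n)))) with hk
        refine hu.not_eventually_le hΩ hω (hbΩ x hxr) hxτ ((innerSL ℝ p).comp
          (T : Cz n →L[ℝ] EuclideanSpace ℝ (Fin (Module.finrank ℝ (Cz n)))))
          (paraboloidForm T A a k) (fun v w => ?_) (hneg _ ⟨x, hxr, rfl⟩ e he a ha) ?_
        · rw [paraboloidForm_apply, paraboloidForm_apply, sumSq_apply, sumSq_apply]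
          simp only [mul_comm (k v), mul_comm (chartCovector T _ v)]
        · have hTx : Tendsto T (𝓝 (T.symm x)) (𝓝 x) := by
            simpa using T.continuous.tendsto (T.symm x)
          filter_upwards [hTx.eventually htouch, hTx.eventually (hnhds x hx)] with y hy hyr
          have h1 : u y ≤ U (T y) := by
            rw [hUcoe _ hyr, T.symm_apply_apply]
            exact le_max_left _ _
          refine h1.trans (EReal.coe_le_coe_iff.2 (hy.trans (le_of_eq ?_)))
          have h2 : T (y - T.symm x) = T y - x := by simp
          rw [paraboloidForm_apply, sumSq_chartCovector_self, hk]
          simp only [ContinuousLinearMap.comp_apply, ContinuousLinearEquiv.coe_coe, h2,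
            innerSL_apply_apply]
          ring
  have h1 := hUcoe _ hmem
  rw [T.symm_apply_apply] at h1
  calc u z₀ ≤ max (u z₀) c := le_max_left _ _
    _ = (U (T z₀) : EReal) := h1.symm
    _ ≤ c := EReal.coe_le_coe_iff.2 hle

theorem OmegaSH.le_of_ae_eq {Ω : Set (Cz n)} (hΩ : IsOpen Ω)
    {ω : Cz n → Matrix (Fin n) (Fin n) ℂ} (hω : IsHermitianMetricOn ω Ω) {u v : Cz n → EReal}
    (hu : OmegaSH ω Ω u) (hv : OmegaSH ω Ω v)
    (hae : ∀ᵐ z ∂(volume.restrict Ω), u z = v z) {z : Cz n} (hz : z ∈ Ω) : u z ≤ v z := by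
  refine EReal.le_of_forall_lt_iff_le.1 fun c hc => ?_
  have hvc : ∀ᶠ y in 𝓝 z, v y < c := by
    have := hv.usc z hz c hc
    rwa [hΩ.nhdsWithin_eq hz] at this
  refine hu.le_of_ae_le hΩ hω hz (hvc.and (hΩ.mem_nhds hz)) ?_
  rw [ae_restrict_iff' hΩ.measurableSet, ae_iff] at hae
  refine measure_mono_null ?_ hae
  rintro y ⟨⟨hy, hyΩ⟩, hcy⟩ h
  exact (hy.trans hcy).ne' (h hyΩ)

end Comparison

/-- Two `ω`-subharmonic functions that agree almost everywhere agree
everywhere. -/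
theorem stmt16 (n : ℕ) (Ω : Set (Cz n)) (hΩo : IsOpen Ω) (hΩb : Bornology.IsBounded Ω)
    (ω : Cz n → Matrix (Fin n) (Fin n) ℂ) (hω : IsHermitianMetricOn ω Ω)
    (u v : Cz n → EReal) (hu : OmegaSH ω Ω u) (hv : OmegaSH ω Ω v)
    (hae : ∀ᵐ z ∂(volume.restrict Ω), u z = v z) :
    ∀ z ∈ Ω, u z = v z := fun _ hz =>
  le_antisymm (hu.le_of_ae_eq hΩo hω hv hae hz)
    (hv.le_of_ae_eq hΩo hω hu (hae.mono fun _ h => h.symm) hz)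
end
end
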